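/- (Alternative spectral resolution) Let E be a σ-lattice effect algebra. If x is an observable and x_t := x((-∞, t]), then x_t ≤ x_s for t < s, ⋀_t x_t = 0, ⋁_t x_t = 1, and ⋀_{t>s} x_t = x_s for each s. Conversely, any system {x_t} satisfying these conditions arises from a unique observable x with x((-∞,t]) = x_t for all t. -/

import Mathlib

structure EffectAlgebra (E : Type*) where
  add : E → E → Option E
  zero : E
  one : E
  comm : ∀ a b, add a b = add b a
  assoc : ∀ a b c, (add a b).bind (fun d => add d c) = (add b c).bind (fun d => add a d)
  orth : ∀ a : E, ∃! b, add a b = some one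
  pos_one : ∀ a b, add a one = some b → a = zero

namespace EffectAlgebra

variable {E : Type*}

/-- The induced order: `a ≤ b` iff `a + c = b` for some `c`. -/
def le (EA : EffectAlgebra E) (a b : E) : Prop := ∃ c, EA.add a c = some b

/-- The orthosupplement `a'`, the unique element with `a + a' = 1`. -/
noncomputable def orthosupp (EA : EffectAlgebra E) (a : E) : E :=
  Classical.choose (EA.orth a).exists

/-- `s` is the supremum of `S` with respect to the induced order. -/
def IsSup (EA : EffectAlgebra E) (S : Set E) (s : E) : Prop :=
  (∀ x ∈ S, EA.le x s) ∧ ∀ b, (∀ x ∈ S, EA.le x b) → EA.le s b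

/-- `s` is the infimum of `S` with respect to the induced order. -/
def IsInf (EA : EffectAlgebra E) (S : Set E) (s : E) : Prop :=
  (∀ x ∈ S, EA.le s x) ∧ ∀ b, (∀ x ∈ S, EA.le b x) → EA.le b s

/-- Every increasing sequence has a supremum. -/
def MonotoneSigmaComplete (EA : EffectAlgebra E) : Prop :=
  ∀ f : ℕ → E, (∀ n, EA.le (f n) (f (n + 1))) → ∃ s, EA.IsSup (Set.range f) s

/-- A σ-lattice effect algebra: countable suprema and infima exist. -/
def SigmaLattice (EA : EffectAlgebra E) : Prop :=
  (∀ f : ℕ → E, ∃ s, EA.IsSup (Set.range f) s) ∧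
  (∀ f : ℕ → E, ∃ s, EA.IsInf (Set.range f) s)

/-- A complete lattice effect algebra: arbitrary suprema and infima exist. -/
def CompleteEA (EA : EffectAlgebra E) : Prop :=
  (∀ S : Set E, ∃ s, EA.IsSup S s) ∧ (∀ S : Set E, ∃ s, EA.IsInf S s)

/-- A lattice effect algebra: binary suprema and infima exist. -/
def LatticeEA (EA : EffectAlgebra E) : Prop :=
  (∀ a b : E, ∃ s, EA.IsSup {a, b} s) ∧ (∀ a b : E, ∃ s, EA.IsInf {a, b} s)

end EffectAlgebra

/-- Borel subsets of the real line. -/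
abbrev BorelSet := {A : Set ℝ // MeasurableSet A}

def bIio (t : ℝ) : BorelSet := ⟨Set.Iio t, measurableSet_Iio⟩
def bIic (t : ℝ) : BorelSet := ⟨Set.Iic t, measurableSet_Iic⟩

/-- An observable on a (monotone σ-complete) effect algebra: a unital,
additive map on the Borel σ-algebra preserving suprema of increasing sequences. -/
structure Observable {E : Type*} (EA : EffectAlgebra E) where
  toFun : BorelSet → E
  unital : toFun ⟨Set.univ, MeasurableSet.univ⟩ = EA.one
  additive : ∀ A B : BorelSet, Disjoint A.1 B.1 →
    EA.add (toFun A) (toFun B) = some (toFun ⟨A.1 ∪ B.1, A.2.union B.2⟩)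
  sup_cont : ∀ f : ℕ → BorelSet, (∀ n, (f n).1 ⊆ (f (n + 1)).1) →
    EA.IsSup (Set.range fun n => toFun (f n))
      (toFun ⟨⋃ n, (f n).1, MeasurableSet.iUnion (fun n => (f n).2)⟩)

namespace Observable

variable {E : Type*} {EA : EffectAlgebra E}

/-- The Olson (spectral) order on observables. -/
def OlsonLe (x y : Observable EA) : Prop :=
  ∀ t : ℝ, EA.le (y.toFun (bIio t)) (x.toFun (bIio t))

/-- An observable is bounded if `x(C) = 1` for some compact set `C`. -/
def Bounded (x : Observable EA) : Prop :=
  ∃ C : Set ℝ, ∃ hC : IsCompact C, x.toFun ⟨C, hC.measurableSet⟩ = EA.one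

/-- `x` is the question observable `q_a` of the element `a`. -/
def IsQuestion (x : Observable EA) (a : E) : Prop :=
  ∀ t : ℝ, x.toFun (bIio t) =
    if t ≤ 0 then EA.zero else if t ≤ 1 then EA.orthosupp a else EA.one

/-- The spectrum of `x` lies in `[0,1]`. -/
def SpectrumIn01 (x : Observable EA) : Prop :=
  x.toFun ⟨Set.Icc 0 1, measurableSet_Icc⟩ = EA.one

/-- `z` is the infimum of `S` in the Olson order on bounded observables. -/
def IsOlsonInf (S : Set (Observable EA)) (z : Observable EA) : Prop :=
  z.Bounded ∧ (∀ x ∈ S, z.OlsonLe x) ∧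
    ∀ w : Observable EA, w.Bounded → (∀ x ∈ S, w.OlsonLe x) → w.OlsonLe z

/-- `z` is the supremum of `S` in the Olson order on bounded observables. -/
def IsOlsonSup (S : Set (Observable EA)) (z : Observable EA) : Prop :=
  z.Bounded ∧ (∀ x ∈ S, x.OlsonLe z) ∧
    ∀ w : Observable EA, w.Bounded → (∀ x ∈ S, x.OlsonLe w) → z.OlsonLe w

end Observable

/-- A spectral resolution: monotone, with infimum 0, supremum 1, left continuous. -/
def SpectralResolution {E : Type*} (EA : EffectAlgebra E) (F : ℝ → E) : Prop :=
  (∀ t s : ℝ, t < s → EA.le (F t) (F s)) ∧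
  EA.IsInf (Set.range F) EA.zero ∧
  EA.IsSup (Set.range F) EA.one ∧
  ∀ s : ℝ, EA.IsSup (F '' Set.Iio s) (F s)


namespace EffectAlgebra

variable {E : Type*} (EA : EffectAlgebra E)

theorem add_comm_some {EA : EffectAlgebra E} {a b c : E} (h : EA.add a b = some c) :
    EA.add b a = some c := by
  rw [EA.comm]; exact h

theorem add_assoc_some {EA : EffectAlgebra E} {a b c d e : E} (h : EA.add a b = some d)
    (h' : EA.add d c = some e) : ∃ f, EA.add b c = some f ∧ EA.add a f = some e := by
  have := EA.assoc a b c
  rw [h, Option.bind_some, h'] at this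
  exact Option.bind_eq_some_iff.1 this.symm

theorem add_assoc_some' {EA : EffectAlgebra E} {a b c d e : E} (h : EA.add b c = some d)
    (h' : EA.add a d = some e) : ∃ f, EA.add a b = some f ∧ EA.add f c = some e := by
  have := EA.assoc a b c
  rw [h, Option.bind_some, h'] at this
  exact Option.bind_eq_some_iff.1 this

theorem add_orthosupp (a : E) : EA.add a (EA.orthosupp a) = some EA.one :=
  Classical.choose_spec (EA.orth a).exists

theorem eq_orthosupp {EA : EffectAlgebra E} {a b : E} (h : EA.add a b = some EA.one) :
    b = EA.orthosupp a :=
  (EA.orth a).unique h (EA.add_orthosupp a)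

theorem orthosupp_orthosupp (a : E) : EA.orthosupp (EA.orthosupp a) = a :=
  (eq_orthosupp (add_comm_some (EA.add_orthosupp a))).symm

theorem add_left_cancel_some {EA : EffectAlgebra E} {a b c d : E} (h : EA.add a b = some d)
    (h' : EA.add a c = some d) : b = c := by
  obtain ⟨f, hf, h1⟩ := add_assoc_some (add_comm_some h) (EA.add_orthosupp d)
  obtain ⟨g, hg, h2⟩ := add_assoc_some (add_comm_some h') (EA.add_orthosupp d)
  obtain rfl : f = g := by simpa [hf] using hg
  rw [eq_orthosupp (add_comm_some h1), ← eq_orthosupp (add_comm_some h2)]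

theorem orthosupp_one : EA.orthosupp EA.one = EA.zero :=
  EA.pos_one _ _ (add_comm_some (EA.add_orthosupp EA.one))

theorem add_zero_some (a : E) : EA.add a EA.zero = some a := by
  have h := EA.add_orthosupp EA.one
  rw [orthosupp_one] at h
  obtain ⟨f, hf, h1⟩ := add_assoc_some (add_comm_some (EA.add_orthosupp a)) h
  have := eq_orthosupp h1
  rw [orthosupp_orthosupp] at this
  rwa [this] at hf

theorem zero_add_some (a : E) : EA.add EA.zero a = some a :=
  add_comm_some (EA.add_zero_some a)

theorem eq_zero_of_add_eq_zero {EA : EffectAlgebra E} {a b : E}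
    (h : EA.add a b = some EA.zero) : a = EA.zero := by
  obtain ⟨f, hf, -⟩ := add_assoc_some (add_comm_some h) (EA.zero_add_some EA.one)
  exact EA.pos_one _ _ hf

theorem le_refl (a : E) : EA.le a a := ⟨_, EA.add_zero_some a⟩

theorem le_trans {EA : EffectAlgebra E} {a b c : E} (h : EA.le a b) (h' : EA.le b c) :
    EA.le a c := by
  obtain ⟨x, hx⟩ := h
  obtain ⟨y, hy⟩ := h'
  obtain ⟨f, -, hf⟩ := add_assoc_some hx hy
  exact ⟨f, hf⟩

theorem le_antisymm {EA : EffectAlgebra E} {a b : E} (h : EA.le a b) (h' : EA.le b a) :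
    a = b := by
  obtain ⟨x, hx⟩ := h
  obtain ⟨y, hy⟩ := h'
  obtain ⟨f, hf, h1⟩ := add_assoc_some hx hy
  have := add_left_cancel_some h1 (EA.add_zero_some a)
  subst this
  rw [eq_zero_of_add_eq_zero hf, EA.add_zero_some] at hx
  simpa using hx

theorem zero_le (a : E) : EA.le EA.zero a := ⟨a, EA.zero_add_some a⟩

theorem le_one (a : E) : EA.le a EA.one := ⟨_, EA.add_orthosupp a⟩

theorem le_add_left_some {EA : EffectAlgebra E} {a b c : E} (h : EA.add a b = some c) :
    EA.le a c := ⟨b, h⟩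

theorem le_add_right_some {EA : EffectAlgebra E} {a b c : E} (h : EA.add a b = some c) :
    EA.le b c := ⟨a, add_comm_some h⟩

theorem add_le_add_iff {EA : EffectAlgebra E} {x a b u v : E} (h : EA.add x a = some u)
    (h' : EA.add x b = some v) : EA.le u v ↔ EA.le a b := by
  constructor
  · rintro ⟨e, he⟩
    obtain ⟨f, hf, h1⟩ := add_assoc_some h he
    obtain rfl := add_left_cancel_some h1 h'
    exact ⟨e, hf⟩
  · rintro ⟨e, he⟩
    obtain ⟨f, hf, h1⟩ := add_assoc_some' he h'
    obtain rfl : u = f := by simpa [h] using hf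
    exact ⟨e, h1⟩

theorem add_defined_iff {EA : EffectAlgebra E} {a b : E} :
    (∃ c, EA.add a b = some c) ↔ EA.le a (EA.orthosupp b) := by
  constructor
  · rintro ⟨c, hc⟩
    obtain ⟨f, hf, h1⟩ := add_assoc_some (add_comm_some hc) (EA.add_orthosupp c)
    rw [← eq_orthosupp h1]
    exact ⟨_, hf⟩
  · rintro ⟨c, hc⟩
    obtain ⟨f, hf, -⟩ := add_assoc_some' hc (EA.add_orthosupp b)
    exact ⟨f, add_comm_some hf⟩

theorem add_defined_mono {EA : EffectAlgebra E} {a b a' b' c : E} (h : EA.add a b = some c)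
    (ha : EA.le a' a) (hb : EA.le b' b) : ∃ c', EA.add a' b' = some c' := by
  obtain ⟨d, hd⟩ := add_defined_iff.2 (le_trans ha (add_defined_iff.1 ⟨c, h⟩))
  have := le_trans hb (add_defined_iff.1 ⟨d, add_comm_some hd⟩)
  obtain ⟨f, hf⟩ := add_defined_iff.2 this
  exact ⟨f, add_comm_some hf⟩

theorem orthosupp_le_orthosupp {EA : EffectAlgebra E} {a b : E} (h : EA.le a b) :
    EA.le (EA.orthosupp b) (EA.orthosupp a) := by
  rw [← add_defined_iff]
  exact add_defined_mono (add_comm_some (EA.add_orthosupp b)) (EA.le_refl _) h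

theorem orthosupp_le_iff {EA : EffectAlgebra E} {a b : E} :
    EA.le (EA.orthosupp a) b ↔ EA.le (EA.orthosupp b) a := by
  constructor <;> intro h <;> simpa [orthosupp_orthosupp] using orthosupp_le_orthosupp h

theorem le_orthosupp_iff {EA : EffectAlgebra E} {a b : E} :
    EA.le a (EA.orthosupp b) ↔ EA.le b (EA.orthosupp a) := by
  constructor <;> intro h <;> simpa [orthosupp_orthosupp] using orthosupp_le_orthosupp h

theorem IsSup.unique {EA : EffectAlgebra E} {S : Set E} {s t : E} (h : EA.IsSup S s)
    (h' : EA.IsSup S t) : s = t :=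
  le_antisymm (h.2 _ h'.1) (h'.2 _ h.1)

theorem IsSup.isInf_orthosupp {EA : EffectAlgebra E} {S : Set E} {s : E} (h : EA.IsSup S s) :
    EA.IsInf (EA.orthosupp '' S) (EA.orthosupp s) := by
  refine ⟨?_, fun b hb => ?_⟩
  · rintro _ ⟨x, hx, rfl⟩
    exact orthosupp_le_orthosupp (h.1 x hx)
  · exact le_orthosupp_iff.1 (h.2 _ fun x hx => le_orthosupp_iff.1 (hb _ ⟨x, hx, rfl⟩))

variable {EA}

theorem SigmaLattice.exists_inf (hE : EA.SigmaLattice) (a b : E) :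
    ∃ m, EA.le m a ∧ EA.le m b ∧ ∀ x, EA.le x a → EA.le x b → EA.le x m := by
  obtain ⟨m, hm, hm'⟩ := hE.2 (fun n => if n = 0 then a else b)
  refine ⟨m, hm _ ⟨0, by simp⟩, hm _ ⟨1, by simp⟩, fun x ha hb => hm' x ?_⟩
  rintro _ ⟨n, rfl⟩
  dsimp only
  split_ifs <;> assumption

theorem SigmaLattice.exists_sup (hE : EA.SigmaLattice) (a b : E) :
    ∃ m, EA.le a m ∧ EA.le b m ∧ ∀ x, EA.le a x → EA.le b x → EA.le m x := by
  obtain ⟨m, hm, hm'⟩ := hE.1 (fun n => if n = 0 then a else b)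
  refine ⟨m, hm _ ⟨0, by simp⟩, hm _ ⟨1, by simp⟩, fun x ha hb => hm' x ?_⟩
  rintro _ ⟨n, rfl⟩
  dsimp only
  split_ifs <;> assumption

/-- The meet of two elements of a σ-lattice effect algebra. -/
noncomputable def SigmaLattice.inf (hE : EA.SigmaLattice) (a b : E) : E :=
  Classical.choose (hE.exists_inf a b)

/-- The join of two elements of a σ-lattice effect algebra. -/
noncomputable def SigmaLattice.sup (hE : EA.SigmaLattice) (a b : E) : E :=
  Classical.choose (hE.exists_sup a b)

namespace SigmaLattice

theorem inf_le_left (hE : EA.SigmaLattice) (a b : E) : EA.le (hE.inf a b) a :=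
  (Classical.choose_spec (hE.exists_inf a b)).1

theorem inf_le_right (hE : EA.SigmaLattice) (a b : E) : EA.le (hE.inf a b) b :=
  (Classical.choose_spec (hE.exists_inf a b)).2.1

theorem le_inf (hE : EA.SigmaLattice) {a b x : E} (ha : EA.le x a) (hb : EA.le x b) :
    EA.le x (hE.inf a b) :=
  (Classical.choose_spec (hE.exists_inf a b)).2.2 x ha hb

theorem le_sup_left (hE : EA.SigmaLattice) (a b : E) : EA.le a (hE.sup a b) :=
  (Classical.choose_spec (hE.exists_sup a b)).1

theorem le_sup_right (hE : EA.SigmaLattice) (a b : E) : EA.le b (hE.sup a b) :=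
  (Classical.choose_spec (hE.exists_sup a b)).2.1

theorem sup_le (hE : EA.SigmaLattice) {a b x : E} (ha : EA.le a x) (hb : EA.le b x) :
    EA.le (hE.sup a b) x :=
  (Classical.choose_spec (hE.exists_sup a b)).2.2 x ha hb

theorem inf_comm (hE : EA.SigmaLattice) (a b : E) : hE.inf a b = hE.inf b a :=
  le_antisymm (hE.le_inf (hE.inf_le_right _ _) (hE.inf_le_left _ _))
    (hE.le_inf (hE.inf_le_right _ _) (hE.inf_le_left _ _))

theorem inf_eq_right (hE : EA.SigmaLattice) {a b : E} (h : EA.le b a) : hE.inf a b = b :=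
  le_antisymm (hE.inf_le_right _ _) (hE.le_inf h (EA.le_refl _))

theorem inf_eq_left (hE : EA.SigmaLattice) {a b : E} (h : EA.le a b) : hE.inf a b = a :=
  le_antisymm (hE.inf_le_left _ _) (hE.le_inf (EA.le_refl _) h)

/-- The truncated difference `a - (a ⊓ b)`. -/
noncomputable def sdiff (hE : EA.SigmaLattice) (a b : E) : E :=
  Classical.choose (hE.inf_le_left a b)

theorem inf_add_sdiff (hE : EA.SigmaLattice) (a b : E) :
    EA.add (hE.inf a b) (hE.sdiff a b) = some a :=
  Classical.choose_spec (hE.inf_le_left a b)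

end SigmaLattice

variable (EA) in
/-- Mackey compatibility: `a ≤ p + b` for some `p ≤ a` orthogonal to `b`. -/
def Compat (a b : E) : Prop :=
  ∃ p w, EA.le p a ∧ EA.add p b = some w ∧ EA.le a w

theorem Compat.symm {a b : E} (h : EA.Compat a b) : EA.Compat b a := by
  obtain ⟨p, w, ⟨d, hd⟩, hw, haw⟩ := h
  obtain ⟨f, hf⟩ := (add_le_add_iff hd hw).1 haw
  obtain ⟨g, hg, hg'⟩ := add_assoc_some' hf hw
  obtain rfl : a = g := by simpa [hd] using hg
  exact ⟨f, w, le_add_right_some hf, add_comm_some hg', le_add_right_some hw⟩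

theorem Compat.of_le {a b : E} (h : EA.le a b) : EA.Compat a b :=
  ⟨EA.zero, b, EA.zero_le _, EA.zero_add_some _, h⟩

theorem Compat.orthosupp_right {a b : E} (h : EA.Compat a b) :
    EA.Compat a (EA.orthosupp b) := by
  obtain ⟨p, w, ⟨d, hd⟩, hw, haw⟩ := h
  have hdb := (add_le_add_iff hd hw).1 haw
  obtain ⟨v, hv⟩ := add_defined_mono (EA.add_orthosupp b) hdb (EA.le_refl _)
  exact ⟨d, v, le_add_right_some hd, hv,
    (add_le_add_iff (add_comm_some hd) hv).2 (add_defined_iff.1 ⟨w, hw⟩)⟩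

theorem Compat.orthosupp_left {a b : E} (h : EA.Compat a b) :
    EA.Compat (EA.orthosupp a) b :=
  h.symm.orthosupp_right.symm

namespace SigmaLattice

theorem compat_of_isSup (hE : EA.SigmaLattice) {S : Set E} {s b : E} (hs : EA.IsSup S s)
    (h : ∀ a ∈ S, EA.Compat a b) : EA.Compat s b := by
  obtain ⟨w, hw⟩ := add_defined_iff.2 (hE.inf_le_right s (EA.orthosupp b))
  refine ⟨_, w, hE.inf_le_left _ _, hw, hs.2 _ fun a ha => ?_⟩
  obtain ⟨p, v, hpa, hv, hav⟩ := h a ha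
  exact le_trans hav ((add_le_add_iff (add_comm_some hv) (add_comm_some hw)).2
    (hE.le_inf (le_trans hpa (hs.1 a ha)) (add_defined_iff.1 ⟨v, hv⟩)))

theorem isSup_sup (hE : EA.SigmaLattice) (a b : E) : EA.IsSup {a, b} (hE.sup a b) := by
  refine ⟨?_, fun c hc => hE.sup_le (hc _ (by simp)) (hc _ (by simp))⟩
  rintro x (rfl | rfl)
  exacts [hE.le_sup_left _ _, hE.le_sup_right _ _]

theorem compat_sup (hE : EA.SigmaLattice) {a b c : E} (ha : EA.Compat a c)
    (hb : EA.Compat b c) : EA.Compat (hE.sup a b) c := by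
  refine hE.compat_of_isSup (hE.isSup_sup a b) ?_
  rintro x (rfl | rfl) <;> assumption

theorem inf_eq_orthosupp_sup (hE : EA.SigmaLattice) (a b : E) :
    hE.inf a b = EA.orthosupp (hE.sup (EA.orthosupp a) (EA.orthosupp b)) := by
  refine le_antisymm ?_ (hE.le_inf ?_ ?_)
  · rw [le_orthosupp_iff]
    exact hE.sup_le (orthosupp_le_orthosupp (hE.inf_le_left _ _))
      (orthosupp_le_orthosupp (hE.inf_le_right _ _))
  · exact orthosupp_le_iff.1 (hE.le_sup_left _ _)
  · exact orthosupp_le_iff.1 (hE.le_sup_right _ _)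

theorem compat_inf (hE : EA.SigmaLattice) {a b c : E} (ha : EA.Compat a c)
    (hb : EA.Compat b c) : EA.Compat (hE.inf a b) c := by
  rw [inf_eq_orthosupp_sup]
  exact (hE.compat_sup ha.orthosupp_left hb.orthosupp_left).orthosupp_left

theorem exists_add_eq_sup (hE : EA.SigmaLattice) {a b : E} (h : EA.Compat a b) :
    ∃ r, EA.le r a ∧ EA.add r b = some (hE.sup a b) := by
  obtain ⟨p, w, hpa, hw, haw⟩ := h
  obtain ⟨r, hr⟩ := hE.le_sup_right a b
  refine ⟨r, le_trans ?_ hpa, add_comm_some hr⟩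
  exact (add_le_add_iff hr (add_comm_some hw)).1 (hE.sup_le haw (le_add_right_some hw))

theorem sdiff_add_defined (hE : EA.SigmaLattice) {a b : E} (h : EA.Compat a b) :
    ∃ w, EA.add (hE.sdiff a b) b = some w ∧ EA.le a w := by
  obtain ⟨p, v, ⟨d, hd⟩, hv, hav⟩ := h
  have hdb := (add_le_add_iff hd hv).1 hav
  obtain ⟨k, hk⟩ := hE.le_inf (le_add_right_some hd) hdb
  obtain ⟨q, hq, hq'⟩ := add_assoc_some hk (hE.inf_add_sdiff a b)
  obtain rfl := add_left_cancel_some hq' (add_comm_some hd)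
  obtain ⟨w, hw⟩ := add_defined_mono hv (le_add_right_some hq) (EA.le_refl b)
  exact ⟨w, hw, (add_le_add_iff (add_comm_some (hE.inf_add_sdiff a b)) hw).2
    (hE.inf_le_right a b)⟩

theorem sdiff_add_eq_sup (hE : EA.SigmaLattice) {a b : E} (h : EA.Compat a b) :
    EA.add (hE.sdiff a b) b = some (hE.sup a b) := by
  obtain ⟨r, ⟨d, hd⟩, hr⟩ := hE.exists_add_eq_sup h
  obtain ⟨w, hw, haw⟩ := hE.sdiff_add_defined h
  have h1 : EA.le r (hE.sdiff a b) :=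
    (add_le_add_iff (add_comm_some hr) (add_comm_some hw)).1
      (hE.sup_le haw (le_add_right_some hw))
  have hdb := (add_le_add_iff hd hr).1 (hE.le_sup_left a b)
  obtain ⟨k, hk⟩ := hE.le_inf (le_add_right_some hd) hdb
  have h2 : EA.le (hE.sdiff a b) r := by
    obtain ⟨q, hq, hq'⟩ := add_assoc_some hk (hE.inf_add_sdiff a b)
    obtain rfl := add_left_cancel_some hq' (add_comm_some hd)
    exact le_add_right_some hq
  rwa [le_antisymm h2 h1]

theorem compat_of_add (hE : EA.SigmaLattice) {a b c z : E} (hz : EA.add a z = some b)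
    (hab : EA.Compat a c) (hbc : EA.Compat b c) : EA.Compat z c := by
  obtain ⟨p, ⟨d, hd⟩, hp⟩ := hE.exists_add_eq_sup hab.symm
  have hda : EA.le d a := (add_le_add_iff hd hp).1 (hE.le_sup_left c a)
  have hbe : EA.Compat b (hE.sup c a) :=
    (hE.compat_sup hbc.symm (Compat.of_le (le_add_left_some hz))).symm
  obtain ⟨w, hw, hbw⟩ := hE.sdiff_add_defined hbe
  have hzp : EA.Compat z p := by
    obtain ⟨g, hg⟩ := hE.le_inf (le_add_left_some hz) (hE.le_sup_right c a)
    obtain ⟨y, hy, hy'⟩ := add_assoc_some hg (hE.inf_add_sdiff b (hE.sup c a))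
    obtain rfl := add_left_cancel_some hy' hz
    obtain ⟨v, hv, hv'⟩ := add_assoc_some' hp hw
    exact ⟨_, v, le_add_right_some hy, hv,
      (add_le_add_iff hz (add_comm_some hv')).1 hbw⟩
  obtain ⟨r, hrz, hr⟩ := hE.exists_add_eq_sup hzp
  have h1 : EA.le (hE.sup z p) (EA.orthosupp d) :=
    hE.sup_le (le_trans (add_defined_iff.1 ⟨b, add_comm_some hz⟩) (orthosupp_le_orthosupp hda))
      (add_defined_iff.1 ⟨c, hd⟩)
  obtain ⟨v, hv⟩ := add_defined_iff.2 h1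
  obtain ⟨u, hu, hu'⟩ := add_assoc_some hr hv
  obtain rfl : c = u := by simpa [hd] using hu
  exact ⟨r, v, hrz, hu', le_trans (hE.le_sup_left z p) (le_add_left_some hv)⟩

theorem compat_sdiff (hE : EA.SigmaLattice) {a b c : E} (ha : EA.Compat a c)
    (hb : EA.Compat b c) : EA.Compat (hE.sdiff a b) c :=
  hE.compat_of_add (hE.inf_add_sdiff a b) (hE.compat_inf ha hb) ha

theorem sdiff_eq_of_add (hE : EA.SigmaLattice) {a b c : E} (h : EA.add b c = some a) :
    hE.sdiff a b = c := by
  have := hE.inf_add_sdiff a b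
  rw [hE.inf_eq_right (le_add_left_some h)] at this
  exact add_left_cancel_some this h

theorem add_sdiff (hE : EA.SigmaLattice) {a b : E} (h : EA.le b a) :
    EA.add b (hE.sdiff a b) = some a := by
  obtain ⟨c, hc⟩ := h
  rwa [hE.sdiff_eq_of_add hc]

theorem sdiff_sdiff_self (hE : EA.SigmaLattice) {a b : E} (h : EA.le b a) :
    hE.sdiff a (hE.sdiff a b) = b :=
  hE.sdiff_eq_of_add (add_comm_some (hE.add_sdiff h))

theorem sdiff_le (hE : EA.SigmaLattice) (a b : E) : EA.le (hE.sdiff a b) a :=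
  le_add_right_some (hE.inf_add_sdiff a b)

theorem sdiff_eq_zero_iff (hE : EA.SigmaLattice) {a b : E} :
    hE.sdiff a b = EA.zero ↔ EA.le a b := by
  have h := hE.inf_add_sdiff a b
  constructor
  · intro h0
    rw [h0, EA.add_zero_some, Option.some_inj] at h
    rw [← h]
    exact hE.inf_le_right a b
  · intro hab
    rw [hE.inf_eq_left hab] at h
    exact add_left_cancel_some h (EA.add_zero_some a)

/-- For compatible elements the truncated sum `a + (b ⊓ a')` is symmetric. -/
theorem truncated_add_comm (hE : EA.SigmaLattice) {a b c : E} (h : EA.Compat a b)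
    (hc : EA.add a (hE.inf b (EA.orthosupp a)) = some c) :
    EA.add b (hE.inf a (EA.orthosupp b)) = some c := by
  have h1 := hE.inf_add_sdiff b (EA.orthosupp a)
  have h2 := hE.sdiff_add_eq_sup h.symm.orthosupp_right
  have h3 : EA.add (hE.sup b (EA.orthosupp a)) (hE.inf a (EA.orthosupp b)) = some EA.one := by
    have := hE.inf_eq_orthosupp_sup (EA.orthosupp b) a
    rw [orthosupp_orthosupp, hE.inf_comm] at this
    rw [this]
    exact EA.add_orthosupp _
  obtain ⟨f, hf, hf'⟩ := add_assoc_some (add_comm_some h2) h3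
  obtain rfl : f = a := by
    rw [eq_orthosupp hf', orthosupp_orthosupp]
  obtain ⟨g, hg, hg'⟩ := add_assoc_some' hf (add_comm_some hc)
  rw [h1, Option.some_inj] at hg
  subst hg
  exact hg'

theorem sdiff_sdiff_decomp (hE : EA.SigmaLattice) (a b c : E) :
    ∃ s, EA.add (hE.inf c a) (hE.inf (hE.sdiff c a) b) = some s ∧
      EA.add s (hE.sdiff (hE.sdiff c a) b) = some c :=
  add_assoc_some' (hE.inf_add_sdiff _ _) (hE.inf_add_sdiff _ _)

theorem sdiff_decomp_le (hE : EA.SigmaLattice) {a b c s t : E} (hab : EA.Compat a b)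
    (hbc : EA.Compat b c)
    (hs : EA.add (hE.inf c a) (hE.inf (hE.sdiff c a) b) = some s)
    (ht : EA.add (hE.inf c b) (hE.inf (hE.sdiff c b) a) = some t) (htc : EA.le t c) :
    EA.le t s := by
  set x := hE.inf c a with hx
  set p := hE.inf (hE.sdiff c b) a with hp
  have hcb : EA.Compat (hE.sdiff c b) b := hE.compat_sdiff hbc.symm (Compat.of_le (EA.le_refl b))
  have hxb : EA.Compat x b := hE.compat_inf hbc.symm hab
  have hpb : EA.Compat p b := hE.compat_inf hcb hab
  have hpx : EA.le p x :=
    hE.le_inf (le_trans (hE.inf_le_left _ _) (hE.sdiff_le _ _)) (hE.inf_le_right _ _)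
  obtain ⟨u, hu⟩ := add_defined_iff.2 (hE.inf_le_right b (EA.orthosupp p))
  obtain ⟨v, hv⟩ := add_defined_iff.2 (hE.inf_le_right b (EA.orthosupp x))
  have hu' := hE.truncated_add_comm hpb (add_comm_some hu)
  have hv' := hE.truncated_add_comm hxb (add_comm_some hv)
  have htu : EA.le t u := (add_le_add_iff (add_comm_some ht) (add_comm_some hu)).2
    (hE.le_inf (hE.inf_le_right _ _) (add_defined_iff.1 ⟨t, ht⟩))
  have huv : EA.le u v := (add_le_add_iff hu' hv').2
    (hE.le_inf (le_trans (hE.inf_le_left _ _) hpx) (hE.inf_le_right _ _))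
  have hxv : EA.le x v := le_add_right_some hv
  obtain ⟨g, hg⟩ := hE.le_sup_right t x
  have h1 : EA.le g (hE.sdiff c a) := (add_le_add_iff hg (hE.inf_add_sdiff c a)).1
    (hE.sup_le htc (hE.inf_le_left _ _))
  have h2 : EA.le g b := le_trans ((add_le_add_iff hg (add_comm_some hv)).1
    (hE.sup_le (le_trans htu huv) hxv)) (hE.inf_le_left _ _)
  exact le_trans (hE.le_sup_left t x) ((add_le_add_iff hg hs).2 (hE.le_inf h1 h2))

theorem sdiff_right_comm (hE : EA.SigmaLattice) {a b c : E} (hab : EA.Compat a b)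
    (hac : EA.Compat a c) (hbc : EA.Compat b c) :
    hE.sdiff (hE.sdiff c a) b = hE.sdiff (hE.sdiff c b) a := by
  obtain ⟨s, hs, hs'⟩ := hE.sdiff_sdiff_decomp a b c
  obtain ⟨t, ht, ht'⟩ := hE.sdiff_sdiff_decomp b a c
  obtain rfl : s = t := le_antisymm
    (hE.sdiff_decomp_le hab.symm hac ht hs (le_add_left_some hs'))
    (hE.sdiff_decomp_le hab hbc hs ht (le_add_left_some ht'))
  exact add_left_cancel_some hs' ht'

end SigmaLattice

end EffectAlgebra

/-- An MV-algebra, presented by its truncated sum, truncated difference and order. -/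
class MVOrder (M : Type*) extends AddCommMonoid M, PartialOrder M, Sub M, OrderTop M,
    IsOrderedAddMonoid M, CanonicallyOrderedAdd M, OrderedSub M where
  sub_sub_self : ∀ a b : M, b ≤ a → a - (a - b) = b

namespace MVOrder

/-- The MV-algebra structure determined by a truncated difference satisfying the axioms of a
bounded commutative BCK-algebra. -/
@[reducible]
def ofSub {M : Type*} [PartialOrder M] [OrderTop M] [Sub M] (z : M)
    (sub_sub_self : ∀ a b : M, b ≤ a → a - (a - b) = b)
    (sub_right_comm : ∀ a b c : M, c - a - b = c - b - a)
    (sub_le : ∀ a b : M, a - b ≤ a)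
    (sub_eq_zero_iff : ∀ a b : M, a - b = z ↔ a ≤ b) : MVOrder M := by
  have hcc : ∀ a : M, ⊤ - (⊤ - a) = a := fun a => sub_sub_self _ _ le_top
  have hinj : ∀ a b : M, (⊤ : M) - a = ⊤ - b → a = b := fun a b h => by
    rw [← hcc a, h, hcc]
  have hz : ∀ a : M, z ≤ a := fun a => by
    rw [← (sub_eq_zero_iff a a).2 le_rfl]
    exact sub_le _ _
  have hsz : ∀ a : M, a - z = a := fun a => by
    have := sub_sub_self a a le_rfl
    rwa [(sub_eq_zero_iff a a).2 le_rfl] at this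
  have hzs : ∀ a : M, z - a = z := fun a => (sub_eq_zero_iff _ _).2 (hz a)
  have htop : ∀ a b : M, a - b = (⊤ - b) - (⊤ - a) := fun a b => by
    conv_lhs => rw [← hcc a]
    exact sub_right_comm _ _ _
  letI : Add M := ⟨fun a b => ⊤ - (⊤ - a - b)⟩
  letI : Zero M := ⟨z⟩
  have hadd : ∀ a b : M, ⊤ - (a + b) = ⊤ - a - b := fun a b => hcc _
  have hsub : ∀ a b c : M, c - (a + b) = c - a - b := fun a b c => by
    rw [htop, hadd, sub_right_comm, ← htop c a]
  have hcomm : ∀ a b : M, a + b = b + a := fun a b => hinj _ _ <| by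
    rw [hadd, hadd, sub_right_comm]
  have hassoc : ∀ a b c : M, a + b + c = a + (b + c) := fun a b c => hinj _ _ <| by
    rw [hadd, hadd, hadd, hsub]
  have hadj : ∀ a b c : M, a - b ≤ c ↔ a ≤ c + b := fun a b c => by
    rw [← sub_eq_zero_iff, ← sub_eq_zero_iff, hcomm, hsub]
  have hself : ∀ a b : M, a ≤ a + b := fun a b => by
    rw [← sub_eq_zero_iff, hsub, (sub_eq_zero_iff a a).2 le_rfl, hzs]
  have hmono : ∀ a b : M, a ≤ b → ∀ c, c + a ≤ c + b := fun a b h c => by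
    rw [hcomm c b, ← hadj]
    refine le_trans ?_ h
    rw [hadj, hcomm]
  exact
    { zero := z
      add := (· + ·)
      nsmul := nsmulRec
      add_assoc := hassoc
      add_comm := hcomm
      zero_add := fun a => hinj _ _ <| by
        change ⊤ - (z + a) = _
        rw [hadd, hsz]
      add_zero := fun a => hinj _ _ <| by
        change ⊤ - (a + z) = _
        rw [hadd, hsz]
      add_le_add_left := fun a b h c => by
        change a + c ≤ b + c
        rw [hcomm a, hcomm b]
        exact hmono a b h c
      exists_add_of_le := fun {a b} h => ⟨b - a, hinj _ _ <| by
        change _ = ⊤ - (a + (b - a))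
        rw [hadd, htop b a, sub_sub_self]
        rw [← sub_eq_zero_iff, ← htop]
        exact (sub_eq_zero_iff _ _).2 h⟩
      le_add_self := fun a b => by
        change a ≤ b + a
        rw [hcomm]
        exact hself a b
      le_self_add := fun a b => hself a b
      tsub_le_iff_right := fun a b c => hadj a b c
      sub_sub_self := sub_sub_self }

end MVOrder

namespace EffectAlgebra

variable {E : Type*} {EA : EffectAlgebra E}

variable (EA) in
/-- A block: a maximal set of pairwise compatible elements. -/
def IsBlock (B : Set E) : Prop :=
  Maximal (fun S : Set E => ∀ a ∈ S, ∀ b ∈ S, EA.Compat a b) B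

theorem exists_isBlock {S : Set E} (hS : ∀ a ∈ S, ∀ b ∈ S, EA.Compat a b) :
    ∃ B, S ⊆ B ∧ EA.IsBlock B := by
  refine zorn_subset_nonempty {S : Set E | ∀ a ∈ S, ∀ b ∈ S, EA.Compat a b} ?_ S hS
  intro c hc hchain _
  refine ⟨⋃₀ c, ?_, fun s hs => Set.subset_sUnion_of_mem hs⟩
  rintro a ⟨s, hs, has⟩ b ⟨t, ht, hbt⟩
  rcases hchain.total hs ht with h | h
  · exact hc ht a (h has) b hbt
  · exact hc hs a has b (h hbt)

namespace IsBlock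

theorem mem_of_compat {B : Set E} (hB : EA.IsBlock B) {a : E}
    (h : ∀ b ∈ B, EA.Compat a b) : a ∈ B := by
  refine hB.le_of_ge (y := insert a B) ?_ (Set.subset_insert a B) (Set.mem_insert a B)
  rintro x (rfl | hx) y (rfl | hy)
  · exact Compat.of_le (EA.le_refl _)
  · exact h y hy
  · exact (h x hx).symm
  · exact hB.prop x hx y hy

theorem one_mem {B : Set E} (hB : EA.IsBlock B) : EA.one ∈ B :=
  hB.mem_of_compat fun b _ => (Compat.of_le (EA.le_one b)).symm

theorem zero_mem {B : Set E} (hB : EA.IsBlock B) : EA.zero ∈ B :=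
  hB.mem_of_compat fun b _ => Compat.of_le (EA.zero_le b)

theorem sdiff_mem {B : Set E} (hB : EA.IsBlock B) (hE : EA.SigmaLattice) {a b : E}
    (ha : a ∈ B) (hb : b ∈ B) : hE.sdiff a b ∈ B :=
  hB.mem_of_compat fun c hc => hE.compat_sdiff (hB.prop a ha c hc) (hB.prop b hb c hc)

theorem isSup_mem {B : Set E} (hB : EA.IsBlock B) (hE : EA.SigmaLattice) {S : Set E} {s : E}
    (hs : EA.IsSup S s) (hS : S ⊆ B) : s ∈ B :=
  hB.mem_of_compat fun c hc => hE.compat_of_isSup hs fun a ha => hB.prop a (hS ha) c hc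

end IsBlock

/-- The order of a block. -/
@[reducible]
def blockPartialOrder (EA : EffectAlgebra E) (B : Set E) : PartialOrder B where
  le a b := EA.le a b
  le_refl a := EA.le_refl a
  le_trans _ _ _ h h' := le_trans h h'
  le_antisymm _ _ h h' := Subtype.ext (le_antisymm h h')

/-- A block of a σ-lattice effect algebra is an MV-algebra. -/
@[reducible]
noncomputable def IsBlock.mvOrder {B : Set E} (hB : EA.IsBlock B) (hE : EA.SigmaLattice) :
    MVOrder B :=
  letI := EA.blockPartialOrder B
  letI : OrderTop B := { top := ⟨EA.one, hB.one_mem⟩, le_top := fun a => EA.le_one a }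
  letI : Sub B := ⟨fun a b => ⟨hE.sdiff a b, hB.sdiff_mem hE a.2 b.2⟩⟩
  MVOrder.ofSub ⟨EA.zero, hB.zero_mem⟩
    (fun _ _ h => Subtype.ext (hE.sdiff_sdiff_self h))
    (fun a b c => Subtype.ext (hE.sdiff_right_comm (hB.prop _ a.2 _ b.2) (hB.prop _ a.2 _ c.2)
      (hB.prop _ b.2 _ c.2)))
    (fun a b => hE.sdiff_le a b)
    (fun _ _ => Subtype.ext_iff.trans hE.sdiff_eq_zero_iff)

end EffectAlgebra

namespace MVOrder

variable {M : Type*} [MVOrder M]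

theorem le_sub_sub {a b c : M} (ha : c ≤ a) (hb : c ≤ b) : c ≤ a - (a - b) := by
  rw [← sub_sub_self a c ha]
  exact tsub_le_tsub_left (tsub_le_tsub_left hb a) a

theorem sub_sub_comm (a b : M) : a - (a - b) = b - (b - a) :=
  le_antisymm (le_sub_sub tsub_tsub_le tsub_le_self) (le_sub_sub tsub_tsub_le tsub_le_self)

theorem sub_sub_sub_self (a b : M) : a - (a - (a - b)) = a - b :=
  sub_sub_self _ _ tsub_le_self

theorem top_sub_top_sub (a : M) : ⊤ - (⊤ - a) = a :=
  sub_sub_self _ _ le_top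

theorem add_sub_cancel_of_le {a b : M} (h : a ≤ ⊤ - b) : a + b - b = a := by
  conv_lhs => rw [← top_sub_top_sub (a + b)]
  rw [tsub_right_comm, add_comm, ← tsub_tsub, sub_sub_self _ _ h]

theorem le_top_sub_comm {a b : M} (h : a ≤ ⊤ - b) : b ≤ ⊤ - a := by
  rw [← top_sub_top_sub b]
  exact tsub_le_tsub_left h _

theorem sub_add_eq_add_sub (a b : M) : a - b + b = a + (b - a) := by
  have h : b - (b - a) + (b - a) = b := tsub_add_cancel_of_le tsub_le_self
  have h' : a - b + (b - (b - a)) = a := by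
    rw [add_comm, ← sub_sub_comm a b]
    exact tsub_add_cancel_of_le tsub_le_self
  calc a - b + b = a - b + (b - (b - a) + (b - a)) := by rw [h]
    _ = a + (b - a) := by rw [← add_assoc, h']

theorem eq_zero_of_le_sub {a b c : M} (h : c ≤ a - b) (h' : c ≤ b - a) : c = 0 := by
  set m := a - (a - b) with hm
  have hm' : m = b - (b - a) := sub_sub_comm a b
  have ha : c + m ≤ a :=
    (add_le_add_left h m).trans (by rw [hm, add_comm, tsub_add_cancel_of_le tsub_le_self])
  have hb : c + m ≤ b :=
    (add_le_add_left h' m).trans (by rw [hm', add_comm, tsub_add_cancel_of_le tsub_le_self])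
  have hle : c ≤ ⊤ - m :=
    (h.trans_eq (sub_sub_sub_self a b).symm).trans (tsub_le_tsub_right le_top m)
  rw [← add_sub_cancel_of_le hle, tsub_eq_zero_iff_le]
  exact le_sub_sub ha hb

theorem eq_zero_of_le_nsmul {u v : M} (h : ∀ x, x ≤ u → x ≤ v → x = 0) (n : ℕ) {x : M}
    (hu : x ≤ n • u) (hv : x ≤ v) : x = 0 := by
  induction n generalizing x with
  | zero => simpa using hu
  | succ n ih =>
    rw [succ_nsmul, ← tsub_le_iff_right] at hu
    have := ih hu (tsub_le_self.trans hv)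
    exact h x (tsub_eq_zero_iff_le.1 this) hv

theorem eq_zero_of_le_nsmul_sub {a b : M} (m n : ℕ) {x : M} (h : x ≤ m • (a - b))
    (h' : x ≤ n • (b - a)) : x = 0 :=
  eq_zero_of_le_nsmul (fun _ hy hy' => eq_zero_of_le_nsmul
    (fun _ hz hz' => eq_zero_of_le_sub hz' hz) n hy' hy) m h h'

theorem sub_le_sub_add {a b x y : M} (h : a ≤ ⊤ - b) :
    b - y ≤ (a + b - (x + y)) + (x - a) := by
  calc b - y = a + b - (a + y) := by
        rw [← tsub_tsub, add_comm a b, add_sub_cancel_of_le (le_top_sub_comm h)]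
    _ ≤ (a + b - (x + y)) + (x + y - (a + y)) := tsub_le_tsub_add_tsub
    _ ≤ _ := add_le_add_right (add_tsub_add_le_tsub_right) _

theorem exists_maximal_isLowerSet {P : AddSubmonoid M} {S : Set M} (hP : IsLowerSet (P : Set M))
    (hS : Disjoint (P : Set M) S) :
    ∃ Q, P ≤ Q ∧ Maximal (fun Q : AddSubmonoid M => IsLowerSet (Q : Set M) ∧
      Disjoint (Q : Set M) S) Q := by
  refine zorn_le_nonempty₀ {Q : AddSubmonoid M | IsLowerSet (Q : Set M) ∧
      Disjoint (Q : Set M) S} ?_ P ⟨hP, hS⟩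
  intro c hc hchain y hy
  have hmem : ∀ x, x ∈ sSup c ↔ ∃ s ∈ c, x ∈ s := fun x =>
    AddSubmonoid.mem_sSup_of_directedOn ⟨y, hy⟩ hchain.directedOn
  refine ⟨sSup c, ⟨?_, ?_⟩, fun z hz => le_sSup hz⟩
  · intro a b hba ha
    obtain ⟨s, hs, has⟩ := (hmem a).1 ha
    exact (hmem b).2 ⟨s, hs, (hc hs).1 hba has⟩
  · refine Set.disjoint_left.2 fun x hx hxS => ?_
    obtain ⟨s, hs, hxs⟩ := (hmem x).1 hx
    exact Set.disjoint_left.1 (hc hs).2 hxs hxS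

theorem exists_le_add_nsmul {P : AddSubmonoid M} {S : Set M}
    (hP : Maximal (fun Q : AddSubmonoid M => IsLowerSet (Q : Set M) ∧ Disjoint (Q : Set M) S) P)
    {u : M} (hu : u ∉ P) : ∃ s ∈ S, ∃ p ∈ P, ∃ n : ℕ, s ≤ p + n • u := by
  by_contra! hcon
  let Q : AddSubmonoid M :=
    { carrier := {x | ∃ p ∈ P, ∃ n : ℕ, x ≤ p + n • u}
      zero_mem' := ⟨0, P.zero_mem, 0, by simp⟩
      add_mem' := by
        rintro a b ⟨p, hp, n, h⟩ ⟨q, hq, m, h'⟩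
        refine ⟨p + q, P.add_mem hp hq, n + m, (add_le_add h h').trans_eq ?_⟩
        rw [add_nsmul, add_add_add_comm] }
  have hQ : IsLowerSet (Q : Set M) ∧ Disjoint (Q : Set M) S := by
    refine ⟨?_, ?_⟩
    · rintro a b hba ⟨p, hp, n, h⟩
      exact ⟨p, hp, n, hba.trans h⟩
    · refine Set.disjoint_left.2 ?_
      rintro x ⟨p, hp, n, h⟩ hx
      exact hcon x hx p hp n h
  have hPQ : P ≤ Q := fun p hp => ⟨p, hp, 0, by simp⟩
  exact hu (hP.le_of_ge hQ hPQ ⟨0, P.zero_mem, 1, by simp⟩)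

theorem sub_mem_or_sub_mem {P : AddSubmonoid M} {S : Set M}
    (hP : Maximal (fun Q : AddSubmonoid M => IsLowerSet (Q : Set M) ∧ Disjoint (Q : Set M) S) P)
    (hS : DirectedOn (· ≥ ·) S) (a b : M) : a - b ∈ P ∨ b - a ∈ P := by
  by_contra! h
  obtain ⟨s, hs, p, hp, n, hn⟩ := exists_le_add_nsmul hP h.1
  obtain ⟨t, ht, q, hq, m, hm⟩ := exists_le_add_nsmul hP h.2
  obtain ⟨r, hr, hrs, hrt⟩ := hS s hs t ht
  have h0 : r - (p + q) = 0 := by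
    refine eq_zero_of_le_nsmul_sub (a := a) (b := b) n m ?_ ?_
    · rw [tsub_le_iff_left]
      refine (hrs.le.trans hn).trans ?_
      gcongr
      exact le_self_add
    · rw [tsub_le_iff_left]
      refine (hrt.le.trans hm).trans ?_
      gcongr
      exact le_add_self
  exact Set.disjoint_left.1 hP.prop.2
    (hP.prop.1 (tsub_eq_zero_iff_le.1 h0) (P.add_mem hp hq)) hr

end MVOrder

namespace MVOrder

variable {M : Type*} [MVOrder M]

/-- A state: a normalized, nonnegative function, additive on orthogonal pairs. -/
structure IsState (ω : M → ℝ) : Prop where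
  nonneg : ∀ a, 0 ≤ ω a
  top : ω ⊤ = 1
  add : ∀ a b, a ≤ ⊤ - b → ω (a + b) = ω a + ω b

/-- An ideal that is maximal among the proper ones. -/
def IsMaxIdeal (Q : AddSubmonoid M) : Prop :=
  Maximal (fun Q : AddSubmonoid M => IsLowerSet (Q : Set M) ∧ Disjoint (Q : Set M) {⊤}) Q

namespace IsMaxIdeal

variable {Q : AddSubmonoid M}

theorem lower (hQ : IsMaxIdeal Q) {a b : M} (h : a ≤ b) (hb : b ∈ Q) : a ∈ Q :=
  hQ.prop.1 h hb

theorem top_notMem (hQ : IsMaxIdeal Q) : ⊤ ∉ Q := fun h =>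
  Set.disjoint_left.1 hQ.prop.2 h rfl

theorem sub_mem_or (hQ : IsMaxIdeal Q) (a b : M) : a - b ∈ Q ∨ b - a ∈ Q :=
  sub_mem_or_sub_mem hQ (directedOn_singleton ⊤) a b

theorem exists_sub_nsmul_mem (hQ : IsMaxIdeal Q) {ε : M} (hε : ε ∉ Q) (a : M) :
    ∃ n : ℕ, a - n • ε ∈ Q := by
  obtain ⟨s, rfl, p, hp, n, h⟩ := exists_le_add_nsmul hQ hε
  refine ⟨n, hQ.lower ?_ hp⟩
  rw [tsub_le_iff_right]
  exact le_top.trans h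

/-- The least `n` such that `a ≤ n • ε` modulo the ideal. -/
noncomputable def count (_ : IsMaxIdeal Q) (ε a : M) : ℕ := sInf {n | a - n • ε ∈ Q}

theorem count_le_iff (hQ : IsMaxIdeal Q) {ε : M} (hε : ε ∉ Q) {a : M} {n : ℕ} :
    hQ.count ε a ≤ n ↔ a - n • ε ∈ Q := by
  refine ⟨fun h => ?_, fun h => Nat.sInf_le h⟩
  refine hQ.lower (tsub_le_tsub_left (nsmul_le_nsmul_left zero_le h) a) ?_
  exact Nat.sInf_mem (s := {n | a - n • ε ∈ Q}) (hQ.exists_sub_nsmul_mem hε a)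

theorem count_mono (hQ : IsMaxIdeal Q) {ε : M} (hε : ε ∉ Q) {a b : M} (h : a ≤ b) :
    hQ.count ε a ≤ hQ.count ε b := by
  rw [hQ.count_le_iff hε]
  exact hQ.lower (tsub_le_tsub_right h _) ((hQ.count_le_iff hε).1 le_rfl)

theorem count_eq_zero (hQ : IsMaxIdeal Q) {ε : M} (hε : ε ∉ Q) {a : M} (h : a ∈ Q) :
    hQ.count ε a = 0 := by
  rw [← Nat.le_zero, hQ.count_le_iff hε]
  simpa using h

theorem count_add_le (hQ : IsMaxIdeal Q) {ε : M} (hε : ε ∉ Q) (a b : M) :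
    hQ.count ε (a + b) ≤ hQ.count ε a + hQ.count ε b := by
  rw [hQ.count_le_iff hε, add_nsmul]
  refine hQ.lower ?_ (Q.add_mem ((hQ.count_le_iff hε (a := a)).1 le_rfl)
    ((hQ.count_le_iff hε (a := b)).1 le_rfl))
  exact add_tsub_add_le_tsub_add_tsub

theorem add_count_le (hQ : IsMaxIdeal Q) {ε : M} (hε : ε ∉ Q) {a b : M} (h : a ≤ ⊤ - b) {i : ℕ}
    (hi : i ≤ hQ.count ε (a + b)) (ha : i • ε - a ∈ Q) :
    i + hQ.count ε b ≤ hQ.count ε (a + b) := by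
  obtain ⟨k, hk⟩ := Nat.exists_eq_add_of_le hi
  rw [hk]
  refine Nat.add_le_add_left ((hQ.count_le_iff hε).2 ?_) i
  refine hQ.lower (sub_le_sub_add h (x := i • ε)) (Q.add_mem ?_ ha)
  rw [← add_nsmul, ← hQ.count_le_iff hε, hk]

theorem count_add_count_le (hQ : IsMaxIdeal Q) {ε : M} (hε : ε ∉ Q) {a b : M} (h : a ≤ ⊤ - b) :
    hQ.count ε a + hQ.count ε b ≤ hQ.count ε (a + b) + 1 := by
  have hab : hQ.count ε a ≤ hQ.count ε (a + b) := hQ.count_mono hε le_self_add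
  rcases hi : hQ.count ε a with _ | i
  · have := hQ.count_mono hε (a := b) (b := a + b) le_add_self
    lia
  · have h1 : a - i • ε ∉ Q := fun hmem => by
      have := (hQ.count_le_iff hε).2 hmem
      lia
    have := hQ.add_count_le hε h (i := i) (by lia) ((hQ.sub_mem_or _ _).resolve_left h1)
    lia

theorem count_add_of_atom (hQ : IsMaxIdeal Q) {ε : M} (hε : ε ∉ Q)
    (hatom : ∀ δ, δ ∈ Q ∨ ε - δ ∈ Q) {a b : M} (h : a ≤ ⊤ - b) :
    hQ.count ε (a + b) = hQ.count ε a + hQ.count ε b := by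
  refine le_antisymm (hQ.count_add_le hε a b) ?_
  refine hQ.add_count_le hε h (hQ.count_mono hε le_self_add) ?_
  rcases hi : hQ.count ε a with _ | i
  · simp
  · have h1 : a - i • ε ∉ Q := fun hmem => by
      have := (hQ.count_le_iff hε).2 hmem
      lia
    have h2 := (hQ.sub_mem_or _ _).resolve_left h1
    refine hQ.lower ?_ (Q.add_mem ((hatom _).resolve_left h1) h2)
    rw [succ_nsmul, tsub_le_iff_right, add_assoc, add_comm (_ - a) a, ← sub_add_eq_add_sub,
      ← add_assoc, add_comm]
    gcongr
    exact le_tsub_add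

theorem exists_double_le (hQ : IsMaxIdeal Q) {ε δ : M} (hδ : δ ∉ Q) (hεδ : ε - δ ∉ Q) :
    ∃ η, η ∉ Q ∧ 2 • η - ε ∈ Q := by
  have h := (hQ.sub_mem_or δ ε).resolve_right hεδ
  rcases hQ.sub_mem_or δ (ε - δ) with h' | h'
  · refine ⟨δ, hδ, hQ.lower ?_ (Q.add_mem h h')⟩
    rw [tsub_le_iff_left, ← add_assoc, ← sub_add_eq_add_sub ε δ, two_nsmul,
      add_comm (ε - δ) δ, add_assoc]
    gcongr
    exact le_add_tsub
  · refine ⟨ε - δ, hεδ, hQ.lower ?_ (Q.add_mem h h')⟩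
    rw [tsub_le_iff_left, ← add_assoc, ← sub_add_eq_add_sub ε δ, two_nsmul, add_assoc]
    gcongr
    exact le_add_tsub

theorem exists_lt_count (hQ : IsMaxIdeal Q)
    (h : ∀ ε, ε ∉ Q → ∃ δ, δ ∉ Q ∧ ε - δ ∉ Q) (n : ℕ) :
    ∃ ε, ε ∉ Q ∧ n + 1 < hQ.count ε ⊤ := by
  induction n with
  | zero =>
    obtain ⟨δ, hδ, hδ'⟩ := h ⊤ hQ.top_notMem
    refine ⟨δ, hδ, ?_⟩
    rw [← not_le, hQ.count_le_iff hδ]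
    simpa using hδ'
  | succ n ih =>
    obtain ⟨ε, hε, hn⟩ := ih
    obtain ⟨δ, hδ, hδ'⟩ := h ε hε
    obtain ⟨η, hη, hη'⟩ := hQ.exists_double_le hδ hδ'
    refine ⟨η, hη, ?_⟩
    rw [← not_le, hQ.count_le_iff hε] at hn
    rw [← not_le]
    intro hle
    replace hle : hQ.count η ⊤ ≤ (n + 1) * 2 := hle.trans (by lia)
    rw [hQ.count_le_iff hη] at hle
    refine hn (hQ.lower (tsub_le_tsub_add_tsub (b := ((n + 1) * 2) • η))
      (Q.add_mem hle (hQ.lower ?_ (Q.nsmul_mem hη' (n + 1)))))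
    rw [mul_nsmul', tsub_le_iff_right, ← nsmul_add]
    exact nsmul_le_nsmul_right le_tsub_add _

theorem exists_almost_state (hQ : IsMaxIdeal Q) (n : ℕ) :
    ∃ ν : M → ℝ, (∀ a, ν a ∈ Set.Icc (0 : ℝ) 1) ∧ ν ⊤ = 1 ∧ (∀ a ∈ Q, ν a = 0) ∧
      ∀ a b, a ≤ ⊤ - b → |ν (a + b) - (ν a + ν b)| ≤ 1 / ((n : ℝ) + 1) := by
  have key : ∃ ε, ε ∉ Q ∧ ∀ a b : M, a ≤ ⊤ - b →
      (hQ.count ε a + hQ.count ε b - hQ.count ε (a + b)) * (n + 1) ≤ hQ.count ε ⊤ := by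
    by_cases h : ∀ ε, ε ∉ Q → ∃ δ, δ ∉ Q ∧ ε - δ ∉ Q
    · obtain ⟨ε, hε, hn⟩ := hQ.exists_lt_count h n
      refine ⟨ε, hε, fun a b hab => ?_⟩
      have := hQ.count_add_count_le hε hab
      calc _ ≤ 1 * (n + 1) := Nat.mul_le_mul_right _ (by lia)
        _ ≤ _ := by lia
    · push Not at h
      obtain ⟨ε, hε, h⟩ := h
      refine ⟨ε, hε, fun a b hab => ?_⟩
      rw [hQ.count_add_of_atom hε (fun δ => or_iff_not_imp_left.2 (h δ)) hab]
      simp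
  obtain ⟨ε, hε, hadd⟩ := key
  have hpos : 0 < hQ.count ε ⊤ := by
    rw [← not_le, hQ.count_le_iff hε]
    simpa using hQ.top_notMem
  have hpos' : (0 : ℝ) < hQ.count ε ⊤ := by exact_mod_cast hpos
  refine ⟨fun a => hQ.count ε a / hQ.count ε ⊤, fun a => ⟨by positivity, ?_⟩,
    div_self hpos'.ne', fun a ha => by simp [hQ.count_eq_zero hε ha], fun a b hab => ?_⟩
  · rw [div_le_one hpos']
    exact_mod_cast hQ.count_mono hε le_top
  · have h1 := hadd a b hab
    have h2 := hQ.count_add_le hε a b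
    obtain ⟨k, hk⟩ := Nat.exists_eq_add_of_le h2
    rw [hk, Nat.add_sub_cancel_left] at h1
    have h3 : (hQ.count ε a : ℝ) + hQ.count ε b = hQ.count ε (a + b) + k := by exact_mod_cast hk
    have h4 : (k : ℝ) * (n + 1) ≤ hQ.count ε ⊤ := by exact_mod_cast h1
    rw [← add_div, h3, ← sub_div, abs_div, abs_of_pos hpos', div_le_div_iff₀ hpos' (by positivity),
      sub_add_cancel_left, abs_neg, Nat.abs_cast]
    linarith

end IsMaxIdeal

theorem exists_isState {P : AddSubmonoid M} (hP : IsLowerSet (P : Set M)) (htop : ⊤ ∉ P) :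
    ∃ ω : M → ℝ, IsState ω ∧ ∀ a ∈ P, ω a = 0 := by
  obtain ⟨Q, hPQ, hQ⟩ := exists_maximal_isLowerSet (S := {⊤}) hP (by simpa using htop)
  replace hQ : IsMaxIdeal Q := hQ
  choose ν hν htopν hzero hadd using hQ.exists_almost_state
  have hlim : ∀ a, ∃ x ∈ Set.Icc (0 : ℝ) 1,
      Filter.Tendsto (fun n => ν n a) (Filter.hyperfilter ℕ) (nhds x) := fun a => by
    refine isCompact_Icc.ultrafilter_le_nhds ((Filter.hyperfilter ℕ).map fun n => ν n a) ?_
    rw [Filter.le_principal_iff]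
    exact Ultrafilter.mem_map.2 (Filter.univ_mem' fun n => hν n a)
  choose ω hω hlim using hlim
  refine ⟨ω, ⟨fun a => (hω a).1, ?_, fun a b hab => ?_⟩, fun a ha => ?_⟩
  · refine tendsto_nhds_unique (hlim ⊤) ?_
    simp [htopν]
  · have h1 := ((hlim (a + b)).sub ((hlim a).add (hlim b))).abs
    have h2 : Filter.Tendsto (fun n : ℕ => 1 / ((n : ℝ) + 1)) (Filter.hyperfilter ℕ) (nhds 0) :=
      tendsto_one_div_add_atTop_nhds_zero_nat.mono_left Nat.hyperfilter_le_atTop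
    have h3 := le_of_tendsto_of_tendsto' h1 h2 fun n => hadd n a b hab
    exact sub_eq_zero.1 (abs_nonpos_iff.1 h3)
  · refine tendsto_nhds_unique (hlim a) ?_
    simp [hzero _ a (hPQ ha)]

namespace IsState

variable {ω : M → ℝ}

theorem sub (h : IsState ω) {a b : M} (hab : a ≤ b) : ω (b - a) = ω b - ω a := by
  rw [eq_sub_iff_add_eq, ← h.add _ _ (tsub_le_tsub_right le_top a), tsub_add_cancel_of_le hab]

theorem mono (h : IsState ω) {a b : M} (hab : a ≤ b) : ω a ≤ ω b := by
  rw [← sub_nonneg, ← h.sub hab]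
  exact h.nonneg _

theorem zero (h : IsState ω) : ω 0 = 0 := by
  simpa using h.add 0 0 zero_le

theorem le_one (h : IsState ω) (a : M) : ω a ≤ 1 := h.top ▸ h.mono le_top

theorem add_le (h : IsState ω) (a b : M) : ω (a + b) ≤ ω a + ω b := by
  have h1 : ω (a + b - b) = ω (a + b) - ω b := h.sub le_add_self
  have h2 : ω (a + b - b) ≤ ω a := h.mono add_tsub_le_right
  linarith

theorem nsmul_le (h : IsState ω) (n : ℕ) (a : M) : ω (n • a) ≤ n * ω a := by
  induction n with
  | zero => simp [h.zero]
  | succ n ih =>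
    rw [succ_nsmul]
    push_cast
    linarith [h.add_le (n • a) a]

end IsState

end MVOrder

namespace MVOrder

variable {M : Type*} [MVOrder M]

variable (M) in
/-- A prime ideal together with a state vanishing on it. -/
structure Point where
  ideal : AddSubmonoid M
  lower : ∀ ⦃a b : M⦄, a ≤ b → b ∈ ideal → a ∈ ideal
  sub_mem_or : ∀ a b : M, a - b ∈ ideal ∨ b - a ∈ ideal
  state : M → ℝ
  isState : IsState state
  state_eq_zero : ∀ a ∈ ideal, state a = 0

/-- Order-density below every nonzero element. -/
def IsOrderDense (D : Set M) : Prop := ∀ c : M, c ≠ 0 → ∃ d ∈ D, d ≠ 0 ∧ d ≤ c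

/-- The points whose ideal misses some element of `D`. -/
def meeting (D : Set M) : Set (Point M) := {p | ∃ d ∈ D, d ∉ p.ideal}

variable (M) in
/-- The filter of sets of points containing a countable intersection of order-dense open sets. -/
def generic : Filter (Point M) := Filter.countableGenerate (meeting '' {D | IsOrderDense D})

instance : CountableInterFilter (generic M) :=
  inferInstanceAs (CountableInterFilter (Filter.countableGenerate _))

theorem meeting_mem_generic {D : Set M} (hD : IsOrderDense D) : meeting D ∈ generic M :=
  Filter.CountableGenerateSets.basic ⟨D, hD, rfl⟩

theorem exists_point {c : M} (hc : c ≠ 0) {D : ℕ → Set M} (hD : ∀ n, IsOrderDense (D n)) :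
    ∃ p : Point M, c ∉ p.ideal ∧ ∀ n, p ∈ meeting (D n) := by
  choose g hgD hg0 hgle using hD
  let f : ℕ → {x : M // x ≠ 0} := fun n =>
    Nat.rec ⟨c, hc⟩ (fun n x => ⟨g n x.1 x.2, hg0 n x.1 x.2⟩) n
  have hf : Antitone fun n => (f n).1 := antitone_nat_of_succ_le fun n => hgle n _ _
  obtain ⟨P, -, hP⟩ := exists_maximal_isLowerSet (P := (⊥ : AddSubmonoid M))
    (S := Set.range fun n => (f n).1)
    (fun a b hba ha => by
      simp only [AddSubmonoid.coe_bot, Set.mem_singleton_iff] at ha ⊢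
      rw [ha] at hba
      simpa using hba)
    (by
      rw [Set.disjoint_left]
      rintro x hx ⟨n, rfl⟩
      exact (f n).2 (by simpa using hx))
  have hfP : ∀ n, (f n).1 ∉ P := fun n h => Set.disjoint_left.1 hP.prop.2 h ⟨n, rfl⟩
  have hprime : ∀ a b : M, a - b ∈ P ∨ b - a ∈ P := by
    refine sub_mem_or_sub_mem hP ?_
    rintro _ ⟨n, rfl⟩ _ ⟨m, rfl⟩
    exact ⟨_, ⟨max n m, rfl⟩, hf (le_max_left n m), hf (le_max_right n m)⟩
  obtain ⟨ω, hω, hωP⟩ := exists_isState hP.prop.1 fun h => hfP 0 (hP.prop.1 le_top h)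
  exact ⟨⟨P, fun _ _ h hb => hP.prop.1 h hb, hprime, ω, hω, hωP⟩, hfP 0,
    fun n => ⟨(f (n + 1)).1, hgD n _ _, hfP (n + 1)⟩⟩

theorem frequently_notMem_ideal {c : M} (hc : c ≠ 0) : ∃ᶠ p in generic M, c ∉ p.ideal := by
  intro h
  obtain ⟨S, hS, hScount, hSsub⟩ := Filter.mem_countableGenerate_iff.1 h
  have hne : (insert (meeting (M := M) Set.univ) S).Nonempty := Set.insert_nonempty _ _
  obtain ⟨f, hf⟩ := (hScount.insert (meeting Set.univ)).exists_eq_range hne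
  have hfD : ∀ n, ∃ D : Set M, IsOrderDense D ∧ meeting D = f n := fun n => by
    have : f n ∈ insert (meeting Set.univ) S := hf ▸ Set.mem_range_self n
    rcases this with h | h
    · exact ⟨Set.univ, fun d hd => ⟨d, trivial, hd, le_rfl⟩, h.symm⟩
    · exact hS h
  choose D hD hDf using hfD
  obtain ⟨p, hp, hpD⟩ := exists_point hc hD
  refine hSsub (Set.mem_sInter.2 fun s hs => ?_) hp
  obtain ⟨n, rfl⟩ : s ∈ Set.range f := hf ▸ Set.mem_insert_of_mem _ hs
  exact hDf n ▸ hpD n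

theorem exists_not_nsmul_le (hM : ∀ f : ℕ → M, ∃ s, IsLUB (Set.range f) s) {d : M} (hd : d ≠ 0) :
    ∃ n : ℕ, ¬ n • d ≤ ⊤ - d := by
  by_contra! h
  obtain ⟨s, hs⟩ := hM fun n => n • d
  have h1 : s ≤ s - d := hs.2 <| by
    rintro _ ⟨n, rfl⟩
    have h2 : n • d + d ≤ s := hs.1 ⟨n + 1, succ_nsmul d n⟩
    exact (add_sub_cancel_of_le (h n)).symm.le.trans (tsub_le_tsub_right h2 d)
  have h3 : d ≤ s := hs.1 ⟨1, one_nsmul d⟩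
  rw [← sub_sub_self s d h3, (h1.antisymm tsub_le_self).symm, tsub_self] at hd
  exact hd rfl

/-- The order is determined by the values of the states at generic points. -/
theorem le_of_eventually_le (hM : ∀ f : ℕ → M, ∃ s, IsLUB (Set.range f) s) {a b : M}
    (h : ∀ᶠ p in generic M, p.state a ≤ p.state b) : a ≤ b := by
  rw [← tsub_eq_zero_iff_le]
  by_contra hd
  set d := a - b with hd'
  obtain ⟨n, hn⟩ := exists_not_nsmul_le hM hd
  rw [← tsub_eq_zero_iff_le] at hn
  obtain ⟨p, hp, hab⟩ := ((frequently_notMem_ideal hn).and_eventually h).exists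
  have hω := p.isState
  have hdP : d ∉ p.ideal := fun hmem => hp (p.lower tsub_le_self (p.ideal.nsmul_mem hmem n))
  have h1 := p.state_eq_zero _ ((p.sub_mem_or _ _).resolve_left hp)
  have h2 := p.state_eq_zero _ ((p.sub_mem_or a b).resolve_left hdP)
  have h3 : p.state ⊤ ≤ p.state (⊤ - d) + p.state d :=
    (hω.mono le_tsub_add).trans (hω.add_le _ _)
  have h4 : p.state (⊤ - d) ≤ p.state (⊤ - d - n • d) + p.state (n • d) :=
    (hω.mono le_tsub_add).trans (hω.add_le _ _)
  have h5 := hω.nsmul_le n d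
  have h6 : p.state (d + b) = p.state d + p.state b :=
    hω.add _ _ (tsub_le_tsub_right le_top b)
  have h7 := hω.add_le a (b - a)
  rw [← sub_add_eq_add_sub, ← hd'] at h7
  have h8 : p.state d ≤ 0 := by linarith
  have h9 : (n : ℝ) * p.state d ≤ 0 := mul_nonpos_of_nonneg_of_nonpos n.cast_nonneg h8
  have := hω.top
  linarith

theorem eq_of_eventually_eq (hM : ∀ f : ℕ → M, ∃ s, IsLUB (Set.range f) s) {a b : M}
    (h : ∀ᶠ p in generic M, p.state a = p.state b) : a = b :=
  le_antisymm (le_of_eventually_le hM (h.mono fun _ h => h.le))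
    (le_of_eventually_le hM (h.mono fun _ h => h.ge))

theorem eq_zero_of_forall_le_nsmul {b : ℕ → M} (hb : Antitone b) (h0 : IsGLB (Set.range b) 0)
    (k : ℕ) {c : M} (hc : ∀ n, c ≤ k • b n) : c = 0 := by
  induction k generalizing c with
  | zero => simpa using hc 0
  | succ k ih =>
    have h : ∀ m, c - b m = 0 := fun m => ih fun n => by
      rw [tsub_le_iff_right]
      refine (hc (max n m)).trans ?_
      rw [succ_nsmul]
      exact add_le_add (nsmul_le_nsmul_right (hb (le_max_left n m)) k) (hb (le_max_right n m))
    refine le_antisymm (h0.2 ?_) zero_le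
    rintro _ ⟨m, rfl⟩
    exact tsub_eq_zero_iff_le.1 (h m)

theorem Point.nsmul_state_le (p : Point M) {b : M} (k : ℕ) (h : ⊤ - k • b ∉ p.ideal) :
    k * p.state b ≤ p.state (k • b) := by
  have hω := p.isState
  induction k with
  | zero => simp [hω.zero]
  | succ k ih =>
    have h1 := ih fun hmem => h (p.lower
      (tsub_le_tsub_left (nsmul_le_nsmul_left zero_le k.le_succ) ⊤) hmem)
    rw [succ_nsmul', ← tsub_tsub] at h
    have h2 := p.state_eq_zero _ ((p.sub_mem_or _ _).resolve_left h)
    have h3 : p.state (k • b - (k • b - (⊤ - b))) = p.state (k • b) := by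
      rw [hω.sub tsub_le_self, h2, sub_zero]
    have h4 := hω.add (k • b - (k • b - (⊤ - b))) b tsub_tsub_le
    have h5 : p.state (k • b - (k • b - (⊤ - b)) + b) ≤ p.state ((k + 1) • b) := by
      rw [succ_nsmul]
      exact hω.mono (add_le_add_left tsub_le_self b)
    push_cast
    linarith

open Filter Topology

theorem eventually_tendsto_zero {b : ℕ → M} (hb : Antitone b) (h0 : IsGLB (Set.range b) 0) :
    ∀ᶠ p in generic M, Tendsto (fun n => p.state (b n)) atTop (𝓝 0) := by
  have hD : ∀ k : ℕ, IsOrderDense {d : M | ∃ n, d ≤ ⊤ - k • b n} := fun k c hc => by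
    have : ∃ n, c - k • b n ≠ 0 := by
      by_contra! h
      exact hc (eq_zero_of_forall_le_nsmul hb h0 k fun n => tsub_eq_zero_iff_le.1 (h n))
    obtain ⟨n, hn⟩ := this
    exact ⟨c - k • b n, ⟨n, tsub_le_tsub_right le_top _⟩, hn, tsub_le_self⟩
  filter_upwards [eventually_countable_forall.2 fun k => meeting_mem_generic (hD k)] with p hp
  have hω := p.isState
  rw [Metric.tendsto_atTop]
  intro ε hε
  obtain ⟨k, hk⟩ := exists_nat_gt (1 / ε)
  obtain ⟨d, ⟨n, hn⟩, hdP⟩ := hp k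
  have h1 := p.nsmul_state_le k fun h => hdP (p.lower hn h)
  have h2 := hω.le_one (k • b n)
  refine ⟨n, fun m hm => ?_⟩
  have h3 : p.state (b m) ≤ p.state (b n) := hω.mono (hb hm)
  rw [Real.dist_eq, sub_zero, abs_of_nonneg (hω.nonneg _)]
  have hk0 : (0 : ℝ) < k := (by positivity : (0 : ℝ) < 1 / ε).trans hk
  refine h3.trans_lt ?_
  rw [div_lt_iff₀ hε] at hk
  by_contra! hcon
  have := mul_le_mul_of_nonneg_left hcon hk0.le
  linarith

theorem eventually_tendsto_of_isGLB {b : ℕ → M} (hb : Antitone b) {g : M}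
    (hg : IsGLB (Set.range b) g) :
    ∀ᶠ p in generic M, Tendsto (fun n => p.state (b n)) atTop (𝓝 (p.state g)) := by
  have hle : ∀ n, g ≤ b n := fun n => hg.1 ⟨n, rfl⟩
  have h0 : IsGLB (Set.range fun n => b n - g) 0 := by
    refine ⟨fun _ _ => zero_le, fun x hx => ?_⟩
    have hx' : ∀ n, x ≤ b n - g := fun n => hx ⟨n, rfl⟩
    have h1 : x + g ≤ g := hg.2 <| by
      rintro _ ⟨n, rfl⟩
      exact (add_le_add_left (hx' n) g).trans_eq (tsub_add_cancel_of_le (hle n))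
    rw [← add_sub_cancel_of_le ((hx' 0).trans (tsub_le_tsub_right le_top g))]
    exact (tsub_eq_zero_iff_le.2 h1).le
  filter_upwards [eventually_tendsto_zero (fun n m h => tsub_le_tsub_right (hb h) g) h0]
    with p hp
  simpa [p.isState.sub (hle _)] using hp.add_const (p.state g)

theorem eventually_tendsto_of_isLUB {a : ℕ → M} (ha : Monotone a) {s : M}
    (hs : IsLUB (Set.range a) s) :
    ∀ᶠ p in generic M, Tendsto (fun n => p.state (a n)) atTop (𝓝 (p.state s)) := by
  have hle : ∀ n, a n ≤ s := fun n => hs.1 ⟨n, rfl⟩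
  have h0 : IsGLB (Set.range fun n => s - a n) 0 := by
    refine ⟨fun _ _ => zero_le, fun x hx => ?_⟩
    have hx' : ∀ n, x ≤ s - a n := fun n => hx ⟨n, rfl⟩
    have h1 : s ≤ s - x := hs.2 <| by
      rintro _ ⟨n, rfl⟩
      rw [← sub_sub_self s (a n) (hle n)]
      exact tsub_le_tsub_left (hx' n) s
    rw [← sub_sub_self s x ((hx' 0).trans tsub_le_self)]
    exact (tsub_eq_zero_iff_le.2 h1).le
  filter_upwards [eventually_tendsto_zero (fun n m h => tsub_le_tsub_left (ha h) s) h0]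
    with p hp
  simpa [p.isState.sub (hle _)] using hp.const_sub (p.state s)

end MVOrder

namespace MVOrder

open Filter Topology MeasureTheory

variable {M : Type*} [MVOrder M]

/-- The element `a` takes, at generic points, the values of the measures `μ` at `A`. -/
def Represents {α : Type*} [MeasurableSpace α] (μ : Point M → Measure α) (A : Set α) (a : M) :
    Prop :=
  ∀ᶠ p in generic M, (μ p).real A = p.state a

section Represents

variable {α : Type*} [MeasurableSpace α] {μ : Point M → Measure α} {A B : Set α} {a b : M}

theorem represents_univ (hμ : ∀ᶠ p in generic M, IsProbabilityMeasure (μ p)) :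
    Represents μ Set.univ ⊤ := by
  filter_upwards [hμ] with p hp
  rw [probReal_univ, p.isState.top]

theorem represents_empty : Represents μ ∅ 0 :=
  Eventually.of_forall fun p => by rw [measureReal_empty, p.isState.zero]

theorem Represents.compl (hμ : ∀ᶠ p in generic M, IsProbabilityMeasure (μ p))
    (ha : Represents μ A a) (hA : MeasurableSet A) : Represents μ Aᶜ (⊤ - a) := by
  filter_upwards [hμ, ha] with p hp h
  rw [probReal_compl_eq_one_sub hA, h, p.isState.sub le_top, p.isState.top]

theorem Represents.le (hM : ∀ f : ℕ → M, ∃ s, IsLUB (Set.range f) s)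
    (hμ : ∀ᶠ p in generic M, IsProbabilityMeasure (μ p))
    (ha : Represents μ A a) (hb : Represents μ B b) (h : A ⊆ B) : a ≤ b := by
  refine le_of_eventually_le hM ?_
  filter_upwards [hμ, ha, hb] with p hp ha hb
  rw [← ha, ← hb]
  exact measureReal_mono h

theorem Represents.unique (hM : ∀ f : ℕ → M, ∃ s, IsLUB (Set.range f) s)
    (ha : Represents μ A a) (hb : Represents μ A b) : a = b :=
  eq_of_eventually_eq hM <| by
    filter_upwards [ha, hb] with p ha hb
    rw [← ha, ← hb]

theorem Represents.le_top_sub (hM : ∀ f : ℕ → M, ∃ s, IsLUB (Set.range f) s)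
    (hμ : ∀ᶠ p in generic M, IsProbabilityMeasure (μ p)) (ha : Represents μ A a)
    (hb : Represents μ B b) (hB : MeasurableSet B) (h : Disjoint A B) : a ≤ ⊤ - b :=
  ha.le hM hμ (hb.compl hμ hB) h.subset_compl_right

theorem Represents.union (hM : ∀ f : ℕ → M, ∃ s, IsLUB (Set.range f) s)
    (hμ : ∀ᶠ p in generic M, IsProbabilityMeasure (μ p)) (ha : Represents μ A a)
    (hb : Represents μ B b) (hB : MeasurableSet B) (h : Disjoint A B) :
    Represents μ (A ∪ B) (a + b) := by
  filter_upwards [hμ, ha, hb] with p hp ha' hb'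
  rw [measureReal_union h hB, p.isState.add _ _ (ha.le_top_sub hM hμ hb hB h), ha', hb']

theorem Represents.iUnion (hM : ∀ f : ℕ → M, ∃ s, IsLUB (Set.range f) s)
    (hμ : ∀ᶠ p in generic M, IsProbabilityMeasure (μ p)) {f : ℕ → Set α} (hf : Monotone f)
    {a : ℕ → M} (ha : ∀ n, Represents μ (f n) (a n)) {s : M} (hs : IsLUB (Set.range a) s) :
    Represents μ (⋃ n, f n) s := by
  have hmono : Monotone a := fun n m h => (ha n).le hM hμ (ha m) (hf h)
  filter_upwards [hμ, eventually_countable_forall.2 ha, eventually_tendsto_of_isLUB hmono hs]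
    with p hp ha hlim
  refine tendsto_nhds_unique ?_ hlim
  simp_rw [← ha]
  exact (ENNReal.tendsto_toReal (measure_ne_top _ _)).comp (tendsto_measure_iUnion_atTop hf)

theorem exists_represents (hM : ∀ f : ℕ → M, ∃ s, IsLUB (Set.range f) s)
    (hμ : ∀ᶠ p in generic M, IsProbabilityMeasure (μ p)) {S : Set (Set α)}
    (hgen : ‹MeasurableSpace α› = MeasurableSpace.generateFrom S) (hpi : IsPiSystem S)
    (hS : ∀ A ∈ S, ∃ a, Represents μ A a) (hA : MeasurableSet A) : ∃ a, Represents μ A a := by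
  induction A, hA using MeasurableSpace.induction_on_inter hgen hpi with
  | empty => exact ⟨0, represents_empty⟩
  | basic t ht => exact hS t ht
  | compl t ht ih =>
    obtain ⟨a, ha⟩ := ih
    exact ⟨_, ha.compl hμ ht⟩
  | iUnion f hd hf ih =>
    choose a ha using ih
    have hfin : ∀ n, ∃ s, Represents μ (⋃ i < n, f i) s := fun n => by
      induction n with
      | zero => exact ⟨0, by simpa using represents_empty⟩
      | succ n ih =>
        obtain ⟨s, hs⟩ := ih
        refine ⟨s + a n, ?_⟩
        rw [Set.biUnion_lt_succ]
        refine hs.union hM hμ (ha n) (hf n) ?_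
        simp only [Set.disjoint_iUnion_left]
        exact fun i hi => hd hi.ne
    choose s hs using hfin
    obtain ⟨t, ht⟩ := hM s
    have hUnion : ⋃ n, ⋃ i < n, f i = ⋃ i, f i := by
      ext x
      simp only [Set.mem_iUnion, exists_prop]
      exact ⟨fun ⟨_, i, _, h⟩ => ⟨i, h⟩, fun ⟨i, h⟩ => ⟨i + 1, i, i.lt_succ_self, h⟩⟩
    refine ⟨t, hUnion ▸ Represents.iUnion hM hμ ?_ hs ht⟩
    exact fun n m hnm => Set.biUnion_subset_biUnion_left fun i hi => lt_of_lt_of_le hi hnm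

end Represents

section Resolution

variable {F : ℝ → M}

theorem _root_.Monotone.state_comp (hF : Monotone F) (p : Point M) :
    Monotone fun t => p.state (F t) :=
  fun _ _ h => p.isState.mono (hF h)

/-- The measure obtained from a monotone family by evaluating a state. -/
noncomputable def pointMeasure (hF : Monotone F) (p : Point M) : Measure ℝ :=
  (hF.state_comp p).stieltjesFunction.measure

theorem eventually_tendsto_stieltjes_atBot (hF : Monotone F) (h0 : IsGLB (Set.range F) 0) :
    ∀ᶠ p in generic M, Tendsto (hF.state_comp p).stieltjesFunction atBot (𝓝 0) := by
  have hanti : Antitone fun n : ℕ => F (-n) := fun n m h => hF (by simpa using h)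
  have hglb : IsGLB (Set.range fun n : ℕ => F (-n)) 0 := by
    refine ⟨fun _ _ => zero_le, fun x hx => h0.2 ?_⟩
    rintro _ ⟨t, rfl⟩
    obtain ⟨n, hn⟩ := exists_nat_gt (-t)
    exact (hx ⟨n, rfl⟩).trans (hF (by linarith))
  filter_upwards [eventually_tendsto_of_isGLB hanti hglb] with p hp
  rw [p.isState.zero] at hp
  refine tendsto_atBot_isGLB (StieltjesFunction.mono _) ⟨?_, fun x hx => ?_⟩
  · rintro _ ⟨t, rfl⟩
    rw [Monotone.stieltjesFunction_eq]
    exact (p.isState.nonneg _).trans ((hF.state_comp p).le_rightLim le_rfl)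
  · refine ge_of_tendsto' hp fun n => (hx ⟨-n - 1, rfl⟩).trans ?_
    rw [Monotone.stieltjesFunction_eq]
    exact (hF.state_comp p).rightLim_le (by linarith)

theorem eventually_tendsto_stieltjes_atTop (hF : Monotone F) (h1 : IsLUB (Set.range F) ⊤) :
    ∀ᶠ p in generic M, Tendsto (hF.state_comp p).stieltjesFunction atTop (𝓝 1) := by
  have hmono : Monotone fun n : ℕ => F n := fun n m h => hF (by simpa using h)
  have hlub : IsLUB (Set.range fun n : ℕ => F n) ⊤ := by
    refine ⟨fun _ _ => le_top, fun x hx => h1.2 ?_⟩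
    rintro _ ⟨t, rfl⟩
    obtain ⟨n, hn⟩ := exists_nat_gt t
    exact (hF hn.le).trans (hx ⟨n, rfl⟩)
  filter_upwards [eventually_tendsto_of_isLUB hmono hlub] with p hp
  rw [p.isState.top] at hp
  refine tendsto_atTop_isLUB (StieltjesFunction.mono _) ⟨?_, fun x hx => ?_⟩
  · rintro _ ⟨t, rfl⟩
    rw [Monotone.stieltjesFunction_eq]
    exact ((hF.state_comp p).rightLim_le (lt_add_one t)).trans (p.isState.le_one _)
  · refine le_of_tendsto' hp fun n => le_trans ?_ (hx ⟨n, rfl⟩)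
    rw [Monotone.stieltjesFunction_eq]
    exact (hF.state_comp p).le_rightLim le_rfl

theorem eventually_stieltjes_eq (hF : Monotone F) {t : ℝ} (ht : IsGLB (F '' Set.Ioi t) (F t)) :
    ∀ᶠ p in generic M, (hF.state_comp p).stieltjesFunction t = p.state (F t) := by
  obtain ⟨u, hu, htu, hlim⟩ := exists_seq_strictAnti_tendsto t
  have hanti : Antitone fun n : ℕ => F (u n) := hF.comp_antitone hu.antitone
  have hglb : IsGLB (Set.range fun n : ℕ => F (u n)) (F t) := by
    refine ⟨?_, fun x hx => ht.2 ?_⟩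
    · rintro _ ⟨n, rfl⟩
      exact hF (htu n).le
    · rintro _ ⟨r, hr, rfl⟩
      obtain ⟨n, hn⟩ := (hlim.eventually_lt_const hr).exists
      exact (hx ⟨n, rfl⟩).trans (hF hn.le)
  filter_upwards [eventually_tendsto_of_isGLB hanti hglb] with p hp
  rw [Monotone.stieltjesFunction_eq]
  refine tendsto_nhds_unique (((hF.state_comp p).tendsto_rightLim t).comp ?_) hp
  exact tendsto_nhdsWithin_iff.2 ⟨hlim, Eventually.of_forall htu⟩

/-- A σ-complete MV-algebra admits functional calculus for resolutions of the unit. -/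
theorem exists_extension (hM : ∀ f : ℕ → M, ∃ s, IsLUB (Set.range f) s) (hF : Monotone F)
    (h0 : IsGLB (Set.range F) 0) (h1 : IsLUB (Set.range F) ⊤)
    (hright : ∀ s, IsGLB (F '' Set.Ioi s) (F s)) :
    ∃ x : BorelSet → M, x ⟨Set.univ, MeasurableSet.univ⟩ = ⊤ ∧
      (∀ A B : BorelSet, Disjoint A.1 B.1 → x A ≤ ⊤ - x B ∧
        x ⟨A.1 ∪ B.1, A.2.union B.2⟩ = x A + x B) ∧
      (∀ f : ℕ → BorelSet, (∀ n, (f n).1 ⊆ (f (n + 1)).1) →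
        IsLUB (Set.range fun n => x (f n))
          (x ⟨⋃ n, (f n).1, MeasurableSet.iUnion fun n => (f n).2⟩)) ∧
      ∀ t, x (bIic t) = F t := by
  have hbot := eventually_tendsto_stieltjes_atBot hF h0
  have hμ : ∀ᶠ p in generic M, IsProbabilityMeasure (pointMeasure hF p) := by
    filter_upwards [hbot, eventually_tendsto_stieltjes_atTop hF h1] with p h h'
    exact StieltjesFunction.isProbabilityMeasure _ h h'
  have hIic : ∀ t, Represents (pointMeasure hF) (Set.Iic t) (F t) := fun t => by
    filter_upwards [hbot, eventually_stieltjes_eq hF (hright t)] with p h h'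
    rw [pointMeasure, measureReal_def, StieltjesFunction.measure_Iic _ h, h', sub_zero,
      ENNReal.toReal_ofReal (p.isState.nonneg _)]
  have hrep : ∀ A : BorelSet, ∃ a, Represents (pointMeasure hF) A.1 a := fun A =>
    exists_represents hM hμ (BorelSpace.measurable_eq.trans (borel_eq_generateFrom_Iic ℝ))
      isPiSystem_Iic (by
        rintro _ ⟨t, rfl⟩
        exact ⟨F t, hIic t⟩) A.2
  choose x hx using hrep
  refine ⟨x, (hx _).unique hM (represents_univ hμ), fun A B hAB => ⟨?_, ?_⟩, fun f hf => ?_,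
    fun t => (hx _).unique hM (hIic t)⟩
  · exact (hx A).le_top_sub hM hμ (hx B) B.2 hAB
  · exact (hx _).unique hM ((hx A).union hM hμ (hx B) B.2 hAB)
  · obtain ⟨s, hs⟩ := hM fun n => x (f n)
    have h := Represents.iUnion hM hμ (monotone_nat_of_le_succ hf) (fun n => hx (f n)) hs
    rwa [(hx ⟨⋃ n, (f n).1, MeasurableSet.iUnion fun n => (f n).2⟩).unique hM h]

end Resolution

end MVOrder

namespace Observable

variable {E : Type*} {EA : EffectAlgebra E} (x y : Observable EA)

open EffectAlgebra

theorem toFun_empty : x.toFun ⟨∅, MeasurableSet.empty⟩ = EA.zero := by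
  have h := x.additive ⟨∅, MeasurableSet.empty⟩ ⟨Set.univ, MeasurableSet.univ⟩
    (Set.empty_disjoint _)
  rw [x.unital] at h
  exact EA.pos_one _ _ h

theorem toFun_mono {A B : BorelSet} (h : A.1 ⊆ B.1) : EA.le (x.toFun A) (x.toFun B) := by
  refine ⟨x.toFun ⟨B.1 \ A.1, B.2.diff A.2⟩, ?_⟩
  rw [x.additive _ _ Set.disjoint_sdiff_right]
  congr 3
  exact Set.union_sdiff_cancel h

theorem toFun_compl (A : BorelSet) :
    x.toFun ⟨A.1ᶜ, A.2.compl⟩ = EA.orthosupp (x.toFun A) := by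
  refine eq_orthosupp ?_
  rw [x.additive _ _ disjoint_compl_right, ← x.unital]
  congr 3
  exact Set.union_compl_self _

theorem inf_cont (f : ℕ → BorelSet) (hf : ∀ n, (f (n + 1)).1 ⊆ (f n).1) :
    EA.IsInf (Set.range fun n => x.toFun (f n))
      (x.toFun ⟨⋂ n, (f n).1, MeasurableSet.iInter fun n => (f n).2⟩) := by
  have h := (x.sup_cont (fun n => ⟨(f n).1ᶜ, (f n).2.compl⟩)
    fun n => Set.compl_subset_compl.2 (hf n)).isInf_orthosupp
  simp only [← toFun_compl] at h
  convert h using 1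
  · ext a
    simp [← toFun_compl]
  · congr 2
    simp [Set.compl_iUnion]

theorem isInf_range_bIic : EA.IsInf (Set.range fun t => x.toFun (bIic t)) EA.zero := by
  refine ⟨fun a _ => EA.zero_le a, fun b hb => ?_⟩
  have h := x.inf_cont (fun n : ℕ => bIic (-n)) fun n => Set.Iic_subset_Iic.2 (by simp)
  have h0 : (⋂ n : ℕ, (bIic (-n)).1) = ∅ := by
    refine Set.eq_empty_of_forall_notMem fun r hr => ?_
    obtain ⟨n, hn⟩ := exists_nat_gt (-r)
    have : r ≤ -n := Set.mem_iInter.1 hr n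
    linarith
  simp only [h0, toFun_empty] at h
  refine h.2 b ?_
  rintro _ ⟨n, rfl⟩
  exact hb _ ⟨_, rfl⟩

theorem isSup_range_bIic : EA.IsSup (Set.range fun t => x.toFun (bIic t)) EA.one := by
  refine ⟨fun a _ => EA.le_one a, fun b hb => ?_⟩
  have h := x.sup_cont (fun n : ℕ => bIic n) fun n => Set.Iic_subset_Iic.2 (by simp)
  have h0 : (⋃ n : ℕ, (bIic n).1) = Set.univ := by
    refine Set.eq_univ_of_forall fun r => ?_
    obtain ⟨n, hn⟩ := exists_nat_gt r
    exact Set.mem_iUnion.2 ⟨n, hn.le⟩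
  simp only [h0, unital] at h
  refine h.2 b ?_
  rintro _ ⟨n, rfl⟩
  exact hb _ ⟨_, rfl⟩

theorem isInf_image_bIic_Ioi (s : ℝ) :
    EA.IsInf ((fun t => x.toFun (bIic t)) '' Set.Ioi s) (x.toFun (bIic s)) := by
  refine ⟨?_, fun b hb => ?_⟩
  · rintro _ ⟨t, ht, rfl⟩
    exact x.toFun_mono (Set.Iic_subset_Iic.2 (Set.mem_Ioi.1 ht).le)
  · obtain ⟨u, hu, hsu, hlim⟩ := exists_seq_strictAnti_tendsto s
    have h := x.inf_cont (fun n : ℕ => bIic (u n))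
      fun n => Set.Iic_subset_Iic.2 (hu.antitone n.le_succ)
    have h0 : (⋂ n : ℕ, (bIic (u n)).1) = Set.Iic s := by
      ext r
      simp only [bIic, Set.mem_iInter, Set.mem_Iic]
      exact ⟨fun hr => ge_of_tendsto' hlim hr, fun hr n => hr.trans (hsu n).le⟩
    simp only [h0] at h
    refine h.2 b ?_
    rintro _ ⟨n, rfl⟩
    exact hb _ ⟨_, hsu n, rfl⟩

variable {x y} in
/-- Observables agreeing on the half-lines `(-∞, t]` are equal. -/
theorem ext_bIic (h : ∀ t, x.toFun (bIic t) = y.toFun (bIic t)) : x = y := by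
  have key : ∀ (A : Set ℝ) (hA : MeasurableSet A), x.toFun ⟨A, hA⟩ = y.toFun ⟨A, hA⟩ := by
    intro A hA
    induction A, hA using MeasurableSpace.induction_on_inter
      (BorelSpace.measurable_eq.trans (borel_eq_generateFrom_Iic ℝ)) isPiSystem_Iic with
    | empty => rw [x.toFun_empty, y.toFun_empty]
    | basic t ht =>
      obtain ⟨t, rfl⟩ := ht
      exact h t
    | compl t ht ih => rw [x.toFun_compl ⟨t, ht⟩, y.toFun_compl ⟨t, ht⟩, ih]
    | iUnion f hd hf ih =>
      let g : ℕ → BorelSet := fun n =>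
        ⟨⋃ i < n, f i, MeasurableSet.biUnion (Set.to_countable _) fun i _ => hf i⟩
      have hg : ∀ n, x.toFun (g n) = y.toFun (g n) := fun n => by
        induction n with
        | zero =>
          have : g 0 = ⟨∅, MeasurableSet.empty⟩ := Subtype.ext (by simp [g])
          rw [this, x.toFun_empty, y.toFun_empty]
        | succ n ihn =>
          have hdisj : Disjoint (g n).1 (f n) := by
            simp only [g, Set.disjoint_iUnion_left]
            exact fun i hi => hd hi.ne
          have : g (n + 1) = ⟨(g n).1 ∪ f n, (g n).2.union (hf n)⟩ :=
            Subtype.ext (Set.biUnion_lt_succ f n)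
          have hx := x.additive (g n) ⟨f n, hf n⟩ hdisj
          have hy := y.additive (g n) ⟨f n, hf n⟩ hdisj
          rw [ihn, ih n, hy] at hx
          rw [this]
          exact (Option.some.inj hx).symm
      have hmono : ∀ n, (g n).1 ⊆ (g (n + 1)).1 := fun n =>
        Set.biUnion_subset_biUnion_left fun i hi => lt_of_lt_of_le hi n.le_succ
      have hU : (⟨⋃ i, f i, .iUnion hf⟩ : BorelSet) =
          ⟨⋃ n, (g n).1, MeasurableSet.iUnion fun n => (g n).2⟩ := by
        refine Subtype.ext ?_
        ext r
        simp only [g, Set.mem_iUnion, exists_prop]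
        exact ⟨fun ⟨i, h⟩ => ⟨i + 1, i, i.lt_succ_self, h⟩, fun ⟨_, i, _, h⟩ => ⟨i, h⟩⟩
      have hsx := x.sup_cont g hmono
      simp only [hg] at hsx
      rw [hU]
      exact hsx.unique (y.sup_cont g hmono)
  have hfun : x.toFun = y.toFun := funext fun A => key A.1 A.2
  cases x
  cases y
  congr

end Observable

namespace EffectAlgebra

variable {E : Type*} {EA : EffectAlgebra E}

theorem exists_observable (hE : EA.SigmaLattice) {F : ℝ → E}
    (hF : ∀ t s : ℝ, t < s → EA.le (F t) (F s)) (h0 : EA.IsInf (Set.range F) EA.zero)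
    (h1 : EA.IsSup (Set.range F) EA.one) (hright : ∀ s : ℝ, EA.IsInf (F '' Set.Ioi s) (F s)) :
    ∃ x : Observable EA, ∀ t, x.toFun (bIic t) = F t := by
  have hcompat : ∀ a ∈ Set.range F, ∀ b ∈ Set.range F, EA.Compat a b := by
    rintro _ ⟨t, rfl⟩ _ ⟨s, rfl⟩
    rcases lt_trichotomy t s with h | rfl | h
    · exact Compat.of_le (hF t s h)
    · exact Compat.of_le (EA.le_refl _)
    · exact (Compat.of_le (hF s t h)).symm
  obtain ⟨B, hFB, hB⟩ := exists_isBlock hcompat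
  let := hB.mvOrder hE
  let G : ℝ → B := fun t => ⟨F t, hFB ⟨t, rfl⟩⟩
  have hlub : ∀ (f : ℕ → B) {s : E} (hs : EA.IsSup (Set.range fun n => (f n : E)) s),
      IsLUB (Set.range f)
        (⟨s, hB.isSup_mem hE hs (Set.range_subset_iff.2 fun n => (f n).2)⟩ : B) := by
    intro f s hs
    refine ⟨?_, fun b hb => hs.2 b ?_⟩
    · rintro _ ⟨n, rfl⟩
      exact hs.1 _ ⟨n, rfl⟩
    · rintro _ ⟨n, rfl⟩
      exact hb ⟨n, rfl⟩
  have hGmono : Monotone G := fun t s h => by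
    rcases h.eq_or_lt with rfl | h
    · exact le_rfl
    · exact hF t s h
  have hG0 : IsGLB (Set.range G) 0 := by
    refine ⟨?_, fun b hb => h0.2 b ?_⟩
    · rintro _ ⟨t, rfl⟩
      exact h0.1 _ ⟨t, rfl⟩
    · rintro _ ⟨t, rfl⟩
      exact hb ⟨t, rfl⟩
  have hG1 : IsLUB (Set.range G) ⊤ := by
    refine ⟨?_, fun b hb => h1.2 b ?_⟩
    · rintro _ ⟨t, rfl⟩
      exact h1.1 _ ⟨t, rfl⟩
    · rintro _ ⟨t, rfl⟩
      exact hb ⟨t, rfl⟩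
  have hGright : ∀ s, IsGLB (G '' Set.Ioi s) (G s) := fun s => by
    refine ⟨?_, fun b hb => (hright s).2 b ?_⟩
    · rintro _ ⟨t, ht, rfl⟩
      exact (hright s).1 _ ⟨t, ht, rfl⟩
    · rintro _ ⟨t, ht, rfl⟩
      exact hb ⟨t, ht, rfl⟩
  obtain ⟨x, hx1, hxadd, hxsup, hxF⟩ := MVOrder.exists_extension
    (fun f => ⟨_, hlub f (hE.1 fun n => (f n : E)).choose_spec⟩) hGmono hG0 hG1 hGright
  refine ⟨⟨fun A => x A, congrArg Subtype.val hx1, fun A C h => ?_, fun f hf => ?_⟩,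
    fun t => congrArg Subtype.val (hxF t)⟩
  · obtain ⟨hle, heq⟩ := hxadd A C h
    have h1 : x A + x C - x A = x C := by
      rw [add_comm]
      exact MVOrder.add_sub_cancel_of_le (MVOrder.le_top_sub_comm hle)
    have h2 : EA.le (x A) (x A + x C : B) := le_self_add (a := x A) (b := x C)
    have h3 := hE.add_sdiff h2
    rw [heq, ← h3]
    congr 1
    exact (congrArg Subtype.val h1).symm
  · obtain ⟨s, hs⟩ := hE.1 fun n => (x (f n) : E)
    have h := (hxsup f hf).unique (hlub (fun n => x (f n)) hs)
    rw [h]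
    exact hs

end EffectAlgebra

/-- STATEMENT 15 (alternative spectral resolution via `(-∞,t]`): for an
observable `x`, the system `x_t := x((-∞,t])` is monotone, with infimum `0`,
supremum `1`, and right-continuous; conversely every such system arises from a
unique observable. -/
theorem stmt15 {E : Type*} (EA : EffectAlgebra E) (hE : EA.SigmaLattice) :
    (∀ x : Observable EA,
      (∀ t s : ℝ, t < s → EA.le (x.toFun (bIic t)) (x.toFun (bIic s))) ∧
      EA.IsInf (Set.range fun t => x.toFun (bIic t)) EA.zero ∧
      EA.IsSup (Set.range fun t => x.toFun (bIic t)) EA.one ∧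
      (∀ s : ℝ, EA.IsInf ((fun t => x.toFun (bIic t)) '' Set.Ioi s) (x.toFun (bIic s)))) ∧
    (∀ F : ℝ → E,
      (∀ t s : ℝ, t < s → EA.le (F t) (F s)) →
      EA.IsInf (Set.range F) EA.zero →
      EA.IsSup (Set.range F) EA.one →
      (∀ s : ℝ, EA.IsInf (F '' Set.Ioi s) (F s)) →
      ∃! x : Observable EA, ∀ t : ℝ, x.toFun (bIic t) = F t) := by
  refine ⟨fun x => ⟨fun t s h => x.toFun_mono (Set.Iic_subset_Iic.2 h.le), x.isInf_range_bIic,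
    x.isSup_range_bIic, x.isInf_image_bIic_Ioi⟩, fun F hF h0 h1 hright => ?_⟩
  obtain ⟨x, hx⟩ := EffectAlgebra.exists_observable hE hF h0 h1 hright
  exact ⟨x, hx, fun y hy => Observable.ext_bIic fun t => (hy t).trans (hx t).symm⟩
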